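/- arXiv:1503.06286 — 2 statements merged into one kernel-verified Lean document; each statement's English description precedes it below -/
import Mathlib

section
/- Let k ≥ 3 and t ≥ 2 be integers and c > 0 a real number, and let λ₂ denote the second largest eigenvalue of T(k,t,c). If H is a connected k-regular finite simple graph with at least M(k,t,c) vertices, then λ₂ ≤ λ₂(H), and equality λ₂ = λ₂(H) holds only if H has exactly M(k,t,c) vertices. -/
open Polynomial

/-- The adjacency matrix of a simple graph over `ℝ` is Hermitian. -/
theorem adjMatrix_isHermitian {V : Type*} [Fintype V] [DecidableEq V]
    (G : SimpleGraph V) [DecidableRel G.Adj] : (G.adjMatrix ℝ).IsHermitian := by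
  rw [Matrix.IsHermitian, Matrix.conjTranspose_eq_transpose_of_trivial]
  exact G.isSymm_adjMatrix

/-- The multiset of adjacency eigenvalues (with multiplicity) of a finite simple graph. -/
noncomputable def eigMultiset {V : Type*} [Fintype V] [DecidableEq V]
    (G : SimpleGraph V) [DecidableRel G.Adj] : Multiset ℝ :=
  Multiset.map (adjMatrix_isHermitian G).eigenvalues Finset.univ.val

/-- The second largest adjacency eigenvalue (with multiplicity) of a finite simple graph:
the second-to-last entry of the nondecreasing sorted list of eigenvalues. -/
noncomputable def secondEigenvalue {V : Type*} [Fintype V] [DecidableEq V]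
    (G : SimpleGraph V) [DecidableRel G.Adj] : ℝ :=
  ((eigMultiset G).sort (· ≤ ·)).getD (((eigMultiset G).sort (· ≤ ·)).length - 2) 0

/-- The largest adjacency eigenvalue (spectral radius) of a finite simple graph. -/
noncomputable def largestEigenvalue {V : Type*} [Fintype V] [DecidableEq V]
    (G : SimpleGraph V) [DecidableRel G.Adj] : ℝ :=
  ((eigMultiset G).sort (· ≤ ·)).getD (((eigMultiset G).sort (· ≤ ·)).length - 1) 0

/-- The orthogonal polynomials `F_i^{(k)}`. -/
noncomputable def Fpoly (k : ℕ) : ℕ → Polynomial ℝ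
  | 0 => 1
  | 1 => X
  | 2 => X ^ 2 - C (k : ℝ)
  | n + 3 => X * Fpoly k (n + 2) - C ((k : ℝ) - 1) * Fpoly k (n + 1)

/-- `G_i = Σ_{j=0}^i F_j`. -/
noncomputable def Gpoly (k : ℕ) (i : ℕ) : Polynomial ℝ :=
  ∑ j ∈ Finset.range (i + 1), Fpoly k j

/-- The tridiagonal matrix `T(k,t,c)`: superdiagonal `(k, k-1, …, k-1)`,
subdiagonal `(1, …, 1, c)`, diagonal chosen so that every row sums to `k`. -/
noncomputable def Tmat (k t : ℕ) (c : ℝ) : Matrix (Fin t) (Fin t) ℝ :=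
  Matrix.of fun i j =>
    if (j : ℕ) = (i : ℕ) + 1 then (if (i : ℕ) = 0 then (k : ℝ) else (k : ℝ) - 1)
    else if (i : ℕ) = (j : ℕ) + 1 then (if (i : ℕ) = t - 1 then c else 1)
    else if i = j then
      (k : ℝ) - (if (i : ℕ) + 1 < t then (if (i : ℕ) = 0 then (k : ℝ) else (k : ℝ) - 1) else 0)
        - (if 0 < (i : ℕ) then (if (i : ℕ) = t - 1 then c else 1) else 0)
    else 0

/-- `M(k,t,c) = 1 + Σ_{i=0}^{t-3} k (k-1)^i + k (k-1)^{t-2} / c`. -/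
noncomputable def Mbound (k t : ℕ) (c : ℝ) : ℝ :=
  1 + (∑ i ∈ Finset.range (t - 2), (k : ℝ) * ((k : ℝ) - 1) ^ i)
    + (k : ℝ) * ((k : ℝ) - 1) ^ (t - 2) / c

open Filter Topology

lemma Gpoly_succ (k i : ℕ) : Gpoly k (i + 1) = Gpoly k i + Fpoly k (i + 1) :=
  Finset.sum_range_succ _ _

lemma Gpoly_zero (k : ℕ) : Gpoly k 0 = 1 := by simp [Gpoly, Fpoly]

lemma Gpoly_one (k : ℕ) : Gpoly k 1 = 1 + X := by
  rw [Gpoly_succ, Gpoly_zero]; simp [Fpoly]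

lemma Gpoly_add_two (k i : ℕ) :
    Gpoly k (i + 2) = X * Gpoly k (i + 1) - C ((k : ℝ) - 1) * Gpoly k i := by
  induction i with
  | zero =>
    rw [Gpoly_succ, Gpoly_one, Gpoly_zero]
    simp only [Fpoly, C_sub, C_1]
    ring
  | succ i ih =>
    have h := Gpoly_succ k (i + 2)
    simp only [Fpoly] at h
    linear_combination h + ih - X * Gpoly_succ k (i + 1) + C ((k : ℝ) - 1) * Gpoly_succ k i

lemma Gpoly_eval_add_two (k i : ℕ) (x : ℝ) :
    (Gpoly k (i + 2)).eval x
      = x * (Gpoly k (i + 1)).eval x - ((k : ℝ) - 1) * (Gpoly k i).eval x := by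
  simp [Gpoly_add_two]

lemma Fpoly_eval_self (k i : ℕ) :
    (Fpoly k (i + 1)).eval (k : ℝ) = k * ((k : ℝ) - 1) ^ i := by
  induction i using Nat.twoStepInduction with
  | zero => simp [Fpoly]
  | one => simp [Fpoly]; ring
  | more i h₁ h₂ =>
    simp only [Fpoly, eval_sub, eval_mul, eval_X, eval_C, h₁, h₂]
    ring

/-- The polynomials `G_i` are positive and nondecreasing in `i` at every `x ≥ k`. -/
lemma Gpoly_eval_pos_le_succ {k : ℕ} (hk : 1 ≤ k) {x : ℝ} (hx : (k : ℝ) ≤ x) (i : ℕ) :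
    0 < (Gpoly k i).eval x ∧ (Gpoly k i).eval x ≤ (Gpoly k (i + 1)).eval x := by
  have hk' : (1 : ℝ) ≤ k := by exact_mod_cast hk
  induction i with
  | zero => simp only [zero_add, Gpoly_zero, Gpoly_one]; simp; linarith
  | succ i ih =>
    refine ⟨ih.1.trans_le ih.2, ?_⟩
    rw [Gpoly_eval_add_two]
    nlinarith [mul_le_mul_of_nonneg_left ih.2 (sub_nonneg.2 hk'),
      mul_nonneg (sub_nonneg.2 hx) (ih.1.le.trans ih.2)]

/-- Christoffel–Darboux formula for the polynomials `G_i`. -/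
lemma Gpoly_christoffelDarboux {k : ℕ} (hk : (k : ℝ) - 1 ≠ 0) (x y : ℝ) (n : ℕ) :
    (x - y) * ∑ i ∈ Finset.range (n + 1),
        (Gpoly k i).eval y / ((k : ℝ) - 1) ^ i * (Gpoly k i).eval x
      = ((Gpoly k n).eval y * (Gpoly k (n + 1)).eval x
          - (Gpoly k (n + 1)).eval y * (Gpoly k n).eval x) / ((k : ℝ) - 1) ^ n := by
  induction n with
  | zero => simp [Gpoly_zero, Gpoly_one]
  | succ n ih =>
    rw [Finset.sum_range_succ, mul_add, ih, Gpoly_eval_add_two, Gpoly_eval_add_two]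
    field_simp
    ring

/-- A continuous function that is negative at `a` and positive far to the right has a largest
zero, which lies to the right of `a`. -/
lemma exists_largest_zero {f : ℝ → ℝ} (hf : Continuous f) {a B : ℝ}
    (hB : ∀ x, B ≤ x → 0 < f x) (ha : f a < 0) :
    ∃ b, a < b ∧ f b = 0 ∧ ∀ x, b < x → 0 < f x := by
  set S : Set ℝ := {x | f x ≤ 0}
  have hbdd : BddAbove S := ⟨B, fun x hx => by
    by_contra h
    exact absurd (hB x (not_le.1 h).le) (not_lt.2 hx)⟩
  have hmem : sSup S ∈ S :=
    (isClosed_le hf continuous_const).csSup_mem ⟨a, ha.le⟩ hbdd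
  have hpos : ∀ x, sSup S < x → 0 < f x := fun x hx => by
    by_contra h
    exact absurd (le_csSup hbdd (not_lt.1 h : x ∈ S)) (not_le.2 hx)
  have h0 : f (sSup S) = 0 := by
    have hlim : Tendsto f (𝓝[>] sSup S) (𝓝 (f (sSup S))) := hf.continuousWithinAt.tendsto
    refine le_antisymm hmem (ge_of_tendsto hlim ?_)
    filter_upwards [self_mem_nhdsWithin] with x hx using (hpos x hx).le
  refine ⟨sSup S, lt_of_le_of_ne (le_csSup hbdd ha.le) fun h => ?_, h0, hpos⟩
  rw [h, h0] at ha
  exact lt_irrefl _ ha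

/-- Beyond the largest zero of `G_{n+1}`, all the polynomials `G_0, …, G_n` are positive. -/
lemma exists_Gpoly_largest_zero {k : ℕ} (hk : 2 ≤ k) (n : ℕ) :
    ∃ r, (Gpoly k (n + 1)).eval r = 0 ∧ (∀ x, r < x → 0 < (Gpoly k (n + 1)).eval x) ∧
      ∀ x, r ≤ x → ∀ j ≤ n, 0 < (Gpoly k j).eval x := by
  have hk' : (2 : ℝ) ≤ k := by exact_mod_cast hk
  induction n with
  | zero =>
    refine ⟨-1, by simp [Gpoly_one], fun x hx => ?_, fun x _ j hj => ?_⟩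
    · simp [Gpoly_one]; linarith
    · simp [Nat.le_zero.1 hj, Gpoly_zero]
  | succ n ih =>
    obtain ⟨r, hr, hgt, hle⟩ := ih
    have hneg : (Gpoly k (n + 2)).eval r < 0 := by
      rw [Gpoly_eval_add_two, hr]
      nlinarith [hle r le_rfl n le_rfl]
    obtain ⟨b, hrb, hb, hbpos⟩ := exists_largest_zero (Gpoly k (n + 2)).continuous
      (fun x hx => (Gpoly_eval_pos_le_succ (by omega) hx (n + 2)).1) hneg
    refine ⟨b, hb, hbpos, fun x hx j hj => ?_⟩
    rcases Nat.le_succ_iff.1 hj with hj | rfl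
    · exact hle x (hrb.le.trans hx) j hj
    · exact hgt x (hrb.trans_le hx)

lemma combination_eval_pos {k : ℕ} (hk : 1 ≤ k) {c : ℝ} (hc : 0 < c) (n : ℕ) {x : ℝ}
    (hx : (k : ℝ) ≤ x) : 0 < (C (c - 1) * Gpoly k n + Gpoly k (n + 1)).eval x := by
  obtain ⟨h₀, h₁⟩ := Gpoly_eval_pos_le_succ hk hx n
  simp only [eval_add, eval_mul, eval_C]
  nlinarith [mul_pos hc h₀]

/-- The polynomials `G_0, …, G_n` are positive at the largest zero of
`(c - 1) G_n + G_{n+1}`. -/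
lemma Gpoly_eval_pos_of_largest_root {k : ℕ} (hk : 2 ≤ k) {c : ℝ} (hc : 0 < c) (n : ℕ) {y : ℝ}
    (hmax : ∀ x : ℝ, (C (c - 1) * Gpoly k n + Gpoly k (n + 1)).IsRoot x → x ≤ y)
    {j : ℕ} (hj : j ≤ n) : 0 < (Gpoly k j).eval y := by
  have hk' : (2 : ℝ) ≤ k := by exact_mod_cast hk
  cases n with
  | zero => simp [Nat.le_zero.1 hj, Gpoly_zero]
  | succ n =>
    obtain ⟨r, hr, hgt, hle⟩ := exists_Gpoly_largest_zero hk n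
    have hneg : (C (c - 1) * Gpoly k (n + 1) + Gpoly k (n + 2)).eval r < 0 := by
      simp only [eval_add, eval_mul, eval_C, Gpoly_eval_add_two, hr]
      nlinarith [hle r le_rfl n le_rfl]
    obtain ⟨b, hrb, hb, -⟩ := exists_largest_zero (Polynomial.continuous _)
      (fun x hx => combination_eval_pos (by omega) hc (n + 1) hx) hneg
    have hry : r < y := hrb.trans_le (hmax b hb)
    rcases Nat.le_succ_iff.1 hj with hj | rfl
    · exact hle y hry.le j hj
    · exact hgt y hry

lemma Mbound_mul {k : ℕ} {c : ℝ} (hc : c ≠ 0) (n : ℕ) :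
    c * Mbound k (n + 2) c = (C (c - 1) * Gpoly k n + Gpoly k (n + 1)).eval (k : ℝ) := by
  have hG : (Gpoly k n).eval (k : ℝ) = 1 + ∑ i ∈ Finset.range n, (k : ℝ) * ((k : ℝ) - 1) ^ i := by
    induction n with
    | zero => simp [Gpoly_zero]
    | succ n ih =>
      rw [Gpoly_succ, eval_add, ih, Fpoly_eval_self, Finset.sum_range_succ, add_assoc]
  rw [Gpoly_succ]
  simp only [eval_add, eval_mul, eval_C, Fpoly_eval_self, hG, Mbound, Nat.add_sub_cancel]
  field_simp
  ring

lemma sum_adjMatrix_apply {V : Type*} [Fintype V] {H : SimpleGraph V} [DecidableRel H.Adj] {k : ℕ}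
    (hreg : H.IsRegularOfDegree k) (v : V) :
    ∑ w, H.adjMatrix ℝ v w = k := by
  simp [SimpleGraph.adjMatrix_apply, ← hreg v, ← SimpleGraph.card_neighborFinset_eq_degree,
    SimpleGraph.neighborFinset_eq_filter]

section Graph

variable {V : Type*} [Fintype V] [DecidableEq V]

/-- The number of non-backtracking walks of length `i + 1` from `u` to `v` whose last edge
is `w v`. -/
def nonbacktrackingCount (H : SimpleGraph V) [DecidableRel H.Adj] : ℕ → V → V → V → ℕ
  | 0, u, w, v => if u = w ∧ H.Adj w v then 1 else 0
  | i + 1, u, w, v =>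
    if H.Adj w v then ∑ x ∈ Finset.univ.erase v, nonbacktrackingCount H i u x w else 0

variable {H : SimpleGraph V} [DecidableRel H.Adj] {k : ℕ}

lemma nonbacktrackingCount_of_not_adj (i : ℕ) (u : V) {w v : V} (h : ¬ H.Adj w v) :
    nonbacktrackingCount H i u w v = 0 := by
  cases i <;> simp [nonbacktrackingCount, h]

/-- The walks that extend a non-backtracking walk by one edge `w v` are the non-backtracking
ones and those whose last edge was `v w`. -/
lemma nonbacktrackingCount_succ (i : ℕ) (u w v : V) :
    (nonbacktrackingCount H (i + 1) u w v : ℝ)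
      = (∑ x, (nonbacktrackingCount H i u x w : ℝ)) * H.adjMatrix ℝ w v
        - nonbacktrackingCount H i u v w := by
  by_cases h : H.Adj w v
  · rw [← Finset.add_sum_erase _ _ (Finset.mem_univ v)]
    simp [nonbacktrackingCount, h]
  · simp [nonbacktrackingCount_of_not_adj _ _ h,
      nonbacktrackingCount_of_not_adj _ _ fun h' => h h'.symm, h]

/-- The entries of `F_i(A)` count non-backtracking walks of length `i`. -/
lemma aeval_Fpoly_succ_apply (hreg : H.IsRegularOfDegree k) (i : ℕ) (u v : V) :
    aeval (H.adjMatrix ℝ) (Fpoly k (i + 1)) u v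
      = ∑ w, (nonbacktrackingCount H i u w v : ℝ) := by
  have h_one (v : V) : H.adjMatrix ℝ u v = ∑ w, (nonbacktrackingCount H 0 u w v : ℝ) := by
    simp [nonbacktrackingCount, SimpleGraph.adjMatrix_apply, ite_and]
  have h_smul (a : ℝ) (p : ℝ[X]) (v : V) :
      aeval (H.adjMatrix ℝ) (C a * p) u v = a * aeval (H.adjMatrix ℝ) p u v := by
    rw [← smul_eq_C_mul, map_smul, Matrix.smul_apply, smul_eq_mul]
  have h_mulX (p : ℝ[X]) (v : V) : aeval (H.adjMatrix ℝ) (p * X) u v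
      = ∑ w, aeval (H.adjMatrix ℝ) p u w * H.adjMatrix ℝ w v := by
    rw [map_mul, aeval_X, Matrix.mul_apply]
  induction i using Nat.twoStepInduction generalizing v with
  | zero => simpa [Fpoly] using h_one v
  | one =>
    have h : Fpoly k 2 = X * X - C (k : ℝ) * 1 := by simp only [Fpoly]; ring
    rw [h, map_sub, Matrix.sub_apply, h_smul, h_mulX]
    simp only [nonbacktrackingCount_succ, Finset.sum_sub_distrib, ← h_one, aeval_X, map_one]
    congr 1
    rw [← sum_adjMatrix_apply hreg v]
    by_cases huv : u = v <;>
      simp [nonbacktrackingCount, huv, SimpleGraph.adjMatrix_apply, Matrix.one_apply]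
  | more i h₁ h₂ =>
    have h : Fpoly k (i + 3) = Fpoly k (i + 2) * X - C ((k : ℝ) - 1) * Fpoly k (i + 1) := by
      simp only [Fpoly]; ring
    rw [h, map_sub, Matrix.sub_apply, h_smul, h_mulX, h₁]
    simp only [h₂, nonbacktrackingCount_succ (i + 1), Finset.sum_sub_distrib]
    congr 1
    simp only [nonbacktrackingCount_succ i, Finset.sum_sub_distrib, ← Finset.mul_sum,
      sum_adjMatrix_apply hreg]
    ring

lemma aeval_Fpoly_apply_eq_natCast (hreg : H.IsRegularOfDegree k) (i : ℕ) (u v : V) :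
    ∃ m : ℕ, aeval (H.adjMatrix ℝ) (Fpoly k i) u v = m := by
  cases i with
  | zero => exact ⟨if u = v then 1 else 0, by simp [Fpoly, Matrix.one_apply]⟩
  | succ i =>
    exact ⟨∑ w, nonbacktrackingCount H i u w v, by simp [aeval_Fpoly_succ_apply hreg]⟩

lemma aeval_Gpoly_succ_apply (i : ℕ) (u v : V) :
    aeval (H.adjMatrix ℝ) (Gpoly k (i + 1)) u v
      = aeval (H.adjMatrix ℝ) (Gpoly k i) u v + aeval (H.adjMatrix ℝ) (Fpoly k (i + 1)) u v := by
  rw [Gpoly_succ, map_add, Matrix.add_apply]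

lemma aeval_Gpoly_apply_mono (hreg : H.IsRegularOfDegree k) (u v : V) :
    Monotone fun i => aeval (H.adjMatrix ℝ) (Gpoly k i) u v := by
  refine monotone_nat_of_le_succ fun i => ?_
  obtain ⟨m, hm⟩ := aeval_Fpoly_apply_eq_natCast hreg (i + 1) u v
  rw [aeval_Gpoly_succ_apply, hm]
  exact le_add_of_nonneg_right m.cast_nonneg

lemma aeval_Gpoly_apply_eq_natCast (hreg : H.IsRegularOfDegree k) (i : ℕ) (u v : V) :
    ∃ m : ℕ, aeval (H.adjMatrix ℝ) (Gpoly k i) u v = m := by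
  induction i with
  | zero => exact ⟨if u = v then 1 else 0, by simp [Gpoly_zero, Matrix.one_apply]⟩
  | succ i ih =>
    obtain ⟨a, ha⟩ := ih
    obtain ⟨b, hb⟩ := aeval_Fpoly_apply_eq_natCast hreg (i + 1) u v
    exact ⟨a + b, by rw [aeval_Gpoly_succ_apply, ha, hb, Nat.cast_add]⟩

/-- The row sums of `p(A)` equal `p(k)`. -/
lemma sum_aeval_adjMatrix_apply (hreg : H.IsRegularOfDegree k) (p : ℝ[X]) (u : V) :
    ∑ v, aeval (H.adjMatrix ℝ) p u v = p.eval (k : ℝ) := by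
  induction p using Polynomial.induction_on' with
  | add p q hp hq => simp [Finset.sum_add_distrib, hp, hq]
  | monomial n a =>
    rw [← C_mul_X_pow_eq_monomial, ← smul_eq_C_mul]
    simp only [map_smul, Matrix.smul_apply, map_pow, aeval_X, smul_eq_mul, ← Finset.mul_sum,
      eval_smul, eval_pow, eval_X]
    congr 1
    induction n with
    | zero => simp [Matrix.one_apply]
    | succ n ih =>
      simp only [pow_succ, Matrix.mul_apply]
      rw [Finset.sum_comm]
      simp only [← Finset.mul_sum, sum_adjMatrix_apply hreg, ← Finset.sum_mul, ih]

lemma isSymm_aeval_adjMatrix (p : ℝ[X]) : (aeval (H.adjMatrix ℝ) p).IsSymm := by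
  induction p using Polynomial.induction_on' with
  | add p q hp hq => rw [map_add]; exact hp.add hq
  | monomial n a =>
    rw [← C_mul_X_pow_eq_monomial, ← smul_eq_C_mul, map_smul, map_pow, aeval_X]
    exact (H.isSymm_adjMatrix.pow n).smul a

/-- The trace of `p(A)` is the sum of the values of `p` at the eigenvalues of `A`. -/
lemma trace_aeval_eq_sum_eval_eigenvalues {A : Matrix V V ℝ} (hA : A.IsHermitian) (p : ℝ[X]) :
    (aeval A p).trace = ∑ i, p.eval (hA.eigenvalues i) := by
  have h : aeval A p = Unitary.conjStarAlgAut ℝ _ hA.eigenvectorUnitary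
      (Matrix.diagonal fun i => p.eval (hA.eigenvalues i)) := by
    have hdiag : (Matrix.diagonal fun i => p.eval (hA.eigenvalues i))
        = aeval (Matrix.diagonal hA.eigenvalues) p := by
      change _ = aeval (Matrix.diagonalAlgHom ℝ hA.eigenvalues) p
      rw [aeval_algHom_apply]
      change _ = Matrix.diagonal _
      congr 1
      ext i
      simp
    conv_lhs => rw [hA.spectral_theorem]
    rw [hdiag]
    exact aeval_algHom_apply
      (Unitary.conjStarAlgAut ℝ _ hA.eigenvectorUnitary).toAlgEquiv.toAlgHom _ p
  rw [h, Unitary.conjStarAlgAut_apply, Matrix.trace_mul_cycle]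
  simp [Matrix.trace]

lemma quadratic_lapMatrix_nonneg (x : V → ℝ) : 0 ≤ x ⬝ᵥ (H.lapMatrix ℝ).mulVec x := by
  rw [← Matrix.toLinearMap₂'_apply', SimpleGraph.lapMatrix_toLinearMap₂']
  positivity

/-- If `p` vanishes at all eigenvalues of `A` other than `k`, then `p(A)` has constant
columns. -/
lemma aeval_apply_eq_of_eval_eq_zero (hconn : H.Connected) (hreg : H.IsRegularOfDegree k)
    (hA : (H.adjMatrix ℝ).IsHermitian) (p : ℝ[X])
    (hp : ∀ i, hA.eigenvalues i = k ∨ p.eval (hA.eigenvalues i) = 0) (u v w : V) :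
    aeval (H.adjMatrix ℝ) p u w = aeval (H.adjMatrix ℝ) p v w := by
  set Y := aeval (H.adjMatrix ℝ) p with hY
  have hL : H.lapMatrix ℝ = aeval (H.adjMatrix ℝ) (C (k : ℝ) - X) := by
    rw [map_sub, aeval_X, aeval_C, Matrix.algebraMap_eq_diagonal]
    simp only [SimpleGraph.lapMatrix, SimpleGraph.degMatrix, hreg.degree_eq]
    rfl
  have htr : (Y * (H.lapMatrix ℝ * Y)).trace = 0 := by
    rw [hL, hY, ← map_mul, ← map_mul, trace_aeval_eq_sum_eval_eigenvalues hA]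
    refine Finset.sum_eq_zero fun i _ => ?_
    rcases hp i with h | h <;> simp [h]
  have hsum : (Y * (H.lapMatrix ℝ * Y)).trace
      = ∑ z, (fun a => Y a z) ⬝ᵥ (H.lapMatrix ℝ).mulVec (fun a => Y a z) := by
    refine Finset.sum_congr rfl fun z _ => ?_
    rw [Matrix.diag_apply, Matrix.mul_apply]
    refine Finset.sum_congr rfl fun a _ => ?_
    rw [show Y z a = Y a z from (isSymm_aeval_adjMatrix p).apply a z]
    rfl
  rw [hsum, Finset.sum_eq_zero_iff_of_nonneg fun z _ => quadratic_lapMatrix_nonneg _] at htr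
  have := htr w (Finset.mem_univ w)
  rw [← Matrix.toLinearMap₂'_apply',
    SimpleGraph.lapMatrix_toLinearMap₂'_apply'_eq_zero_iff_forall_reachable] at this
  exact this u v (hconn u v)

lemma exists_eigenvalues_eq_degree [Nonempty V] (hreg : H.IsRegularOfDegree k)
    (hA : (H.adjMatrix ℝ).IsHermitian) : ∃ i, hA.eigenvalues i = k := by
  have h : (k : ℝ) ∈ spectrum ℝ (H.adjMatrix ℝ) := by
    rw [Matrix.mem_spectrum_iff_isRoot_charpoly, IsRoot.def, Matrix.eval_charpoly,
      ← Matrix.exists_mulVec_eq_zero_iff]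
    refine ⟨Function.const _ 1, fun h => one_ne_zero (congrFun h (Classical.arbitrary V)), ?_⟩
    ext v
    simp [Matrix.sub_mulVec, hreg.degree_eq]
  rwa [hA.spectrum_real_eq_range_eigenvalues] at h

/-- All eigenvalues but one are at most the second largest one. -/
lemma exists_forall_ne_eigenvalues_le_secondEigenvalue (hV : 2 ≤ Fintype.card V) :
    ∃ i, ∀ j ≠ i, (adjMatrix_isHermitian H).eigenvalues j ≤ secondEigenvalue H := by
  set e := (adjMatrix_isHermitian H).eigenvalues
  set L := (eigMultiset H).sort (· ≤ ·) with hL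
  have hcoe : (L : Multiset ℝ) = eigMultiset H := Multiset.sort_eq _ _
  have hlen : L.length = Fintype.card V := by
    rw [← Multiset.coe_card, hcoe, eigMultiset, Multiset.card_map]; rfl
  have hsorted : L.Pairwise (· ≤ ·) := Multiset.pairwise_sort _ _
  have hne : L ≠ [] := by
    rintro h; simp [h] at hlen; omega
  have hsecond : secondEigenvalue H = L[L.length - 2]'(by omega) :=
    List.getD_eq_getElem _ _ _
  have hsplit : (L.getLast hne) ::ₘ (L.dropLast : Multiset ℝ) = eigMultiset H := by
    rw [← hcoe, Multiset.cons_coe, Multiset.coe_eq_coe]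
    conv_rhs => rw [← List.dropLast_append_getLast hne]
    exact (List.perm_append_singleton _ _).symm
  obtain ⟨i, -, hi⟩ : ∃ i ∈ Finset.univ.val, e i = L.getLast hne := by
    rw [← Multiset.mem_map]
    change L.getLast hne ∈ eigMultiset H
    rw [← hsplit]
    exact Multiset.mem_cons_self _ _
  refine ⟨i, fun j hj => ?_⟩
  have hrest : (L.dropLast : Multiset ℝ) = (Finset.univ.erase i).val.map e := by
    rw [← Multiset.cons_inj_right (L.getLast hne), hsplit, ← hi, ← Multiset.map_cons,
      Finset.erase_val, Multiset.cons_erase (Finset.mem_univ_val i)]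
    rfl
  have hmem : e j ∈ L.dropLast := by
    rw [← Multiset.mem_coe, hrest]
    exact Multiset.mem_map_of_mem _ (Finset.mem_erase.2 ⟨hj, Finset.mem_univ j⟩)
  obtain ⟨m, hm, hmj⟩ := List.getElem_of_mem hmem
  rw [List.length_dropLast] at hm
  rw [← hmj, List.getElem_dropLast, hsecond]
  exact hsorted.rel_get_of_le (a := ⟨m, by omega⟩) (b := ⟨L.length - 2, by omega⟩)
    (Fin.mk_le_mk.2 (by omega))

end Graph

theorem stmt6 (k t : ℕ) (hk : 3 ≤ k) (ht : 2 ≤ t) (c : ℝ) (hc : 0 < c) (lam2 : ℝ)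
    (hroot : (C (c - 1) * Gpoly k (t - 2) + Gpoly k (t - 1)).IsRoot lam2)
    (hmax : ∀ x : ℝ, (C (c - 1) * Gpoly k (t - 2) + Gpoly k (t - 1)).IsRoot x → x ≤ lam2)
    {V : Type*} [Fintype V] [DecidableEq V] (H : SimpleGraph V) [DecidableRel H.Adj]
    (hconn : H.Connected) (hreg : H.IsRegularOfDegree k)
    (hcard : Mbound k t c ≤ (Fintype.card V : ℝ)) :
    lam2 ≤ secondEigenvalue H ∧
      (lam2 = secondEigenvalue H → (Fintype.card V : ℝ) = Mbound k t c) := by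
  obtain ⟨n, rfl⟩ : ∃ n, t = n + 2 := ⟨t - 2, by omega⟩
  simp only [Nat.add_sub_cancel, show n + 2 - 1 = n + 1 from rfl] at hroot hmax
  have hq : 0 < (k : ℝ) - 1 := by
    have : (3 : ℝ) ≤ k := by exact_mod_cast hk
    linarith
  set hA := adjMatrix_isHermitian H
  set P := C (c - 1) * Gpoly k n + Gpoly k (n + 1) with hP
  have hGpos : ∀ j ≤ n, 0 < (Gpoly k j).eval lam2 := fun j hj =>
    Gpoly_eval_pos_of_largest_root (by omega) hc n hmax hj
  set a : ℕ → ℝ := fun i => (Gpoly k i).eval lam2 / ((k : ℝ) - 1) ^ i with ha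
  have hapos : ∀ i ∈ Finset.range (n + 1), 0 < a i := fun i hi =>
    div_pos (hGpos i (Finset.mem_range_succ_iff.1 hi)) (pow_pos hq i)
  set g : ℝ[X] := ∑ i ∈ Finset.range (n + 1), C (a i) * Gpoly k i with hg
  have hfactor (x : ℝ) : (x - lam2) * g.eval x = a n * P.eval x := by
    have h0 : (c - 1) * (Gpoly k n).eval lam2 + (Gpoly k (n + 1)).eval lam2 = 0 := by
      simpa [hP] using hroot
    have hgx : g.eval x = ∑ i ∈ Finset.range (n + 1), a i * (Gpoly k i).eval x := by
      simp [hg, eval_finsetSum]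
    rw [hgx, Gpoly_christoffelDarboux hq.ne', eq_neg_of_add_eq_zero_right h0]
    simp only [hP, ha, eval_add, eval_mul, eval_C]
    ring
  have han : 0 < a n := hapos n (Finset.self_mem_range_succ n)
  have hPk {x : ℝ} (hx : (k : ℝ) ≤ x) : 0 < P.eval x := combination_eval_pos (by omega) hc n hx
  have hlam : lam2 < k := by
    by_contra h
    exact (hPk (not_lt.1 h)).ne' hroot
  have hgk : 0 < g.eval (k : ℝ) := by
    have := hfactor k
    exact pos_of_mul_pos_right (this ▸ mul_pos han (hPk le_rfl)) (sub_pos.2 hlam).le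
  -- the entries of `g(A)` and `P(A)`
  set Y := aeval (H.adjMatrix ℝ) g with hY
  set Q := aeval (H.adjMatrix ℝ) P with hQ
  have hYapply (u v : V) : Y u v
      = ∑ i ∈ Finset.range (n + 1), a i * aeval (H.adjMatrix ℝ) (Gpoly k i) u v := by
    simp only [hY, hg, map_sum, Matrix.sum_apply, ← smul_eq_C_mul, map_smul, Matrix.smul_apply,
      smul_eq_mul]
  have hQapply (u v : V) : Q u v = c * aeval (H.adjMatrix ℝ) (Gpoly k n) u v
      + aeval (H.adjMatrix ℝ) (Fpoly k (n + 1)) u v := by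
    simp only [hQ, hP, map_add, ← smul_eq_C_mul, map_smul, Matrix.add_apply, Matrix.smul_apply,
      smul_eq_mul, aeval_Gpoly_succ_apply]
    ring
  have hGnonneg (i : ℕ) (u v : V) : 0 ≤ aeval (H.adjMatrix ℝ) (Gpoly k i) u v := by
    obtain ⟨m, hm⟩ := aeval_Gpoly_apply_eq_natCast hreg i u v
    exact hm ▸ m.cast_nonneg
  have hFnonneg (i : ℕ) (u v : V) : 0 ≤ aeval (H.adjMatrix ℝ) (Fpoly k i) u v := by
    obtain ⟨m, hm⟩ := aeval_Fpoly_apply_eq_natCast hreg i u v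
    exact hm ▸ m.cast_nonneg
  have hYnonneg (u v : V) : 0 ≤ Y u v := by
    rw [hYapply]
    exact Finset.sum_nonneg fun i hi => mul_nonneg (hapos i hi).le (hGnonneg i u v)
  have hGn (u v : V) (h : Y u v ≠ 0) : 1 ≤ aeval (H.adjMatrix ℝ) (Gpoly k n) u v := by
    obtain ⟨m, hm⟩ := aeval_Gpoly_apply_eq_natCast hreg n u v
    rw [hm, Nat.one_le_cast, Nat.one_le_iff_ne_zero]
    rintro rfl
    refine h ?_
    rw [hYapply]
    refine Finset.sum_eq_zero fun i hi => ?_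
    have := aeval_Gpoly_apply_mono hreg u v (Finset.mem_range_succ_iff.1 hi)
    rw [le_antisymm (by simpa [hm] using this) (hGnonneg i u v), mul_zero]
  have hentry (u v : V) : c * Y u v ≤ Q u v * Y u v := by
    by_cases h : Y u v = 0
    · simp [h]
    · refine mul_le_mul_of_nonneg_right ?_ (hYnonneg u v)
      rw [hQapply]
      nlinarith [hGn u v h, hFnonneg (n + 1) u v]
  have hrow (u : V) : ∑ v, c * Y u v = c * g.eval (k : ℝ) := by
    rw [← Finset.mul_sum, sum_aeval_adjMatrix_apply hreg]
  have htrace : ∑ i, P.eval (hA.eigenvalues i) * g.eval (hA.eigenvalues i)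
      = ∑ u, ∑ v, Q u v * Y u v := by
    simp only [← eval_mul]
    rw [← trace_aeval_eq_sum_eval_eigenvalues, map_mul]
    refine Finset.sum_congr rfl fun u _ => ?_
    rw [Matrix.diag_apply, Matrix.mul_apply]
    exact Finset.sum_congr rfl fun v _ => by
      rw [show Y u v = Y v u from (isSymm_aeval_adjMatrix g).apply v u]
  have : Nonempty V := hconn.nonempty
  have hV : 2 ≤ Fintype.card V := by
    have := hreg.degree_eq (Classical.arbitrary V) ▸ H.degree_lt_card_verts _
    omega
  obtain ⟨i₀, hi₀⟩ := exists_forall_ne_eigenvalues_le_secondEigenvalue (H := H) hV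
  obtain ⟨i₁, hi₁⟩ := exists_eigenvalues_eq_degree hreg hA
  have hPg (x : ℝ) (hx : x ≤ lam2) : P.eval x * g.eval x ≤ 0 := by
    refine nonpos_of_mul_nonpos_right (b := P.eval x * g.eval x) ?_ han
    rw [← mul_assoc, ← hfactor]
    nlinarith [mul_nonneg (sub_nonneg.2 hx) (sq_nonneg (g.eval x))]
  have hk₀ (hle : secondEigenvalue H ≤ lam2) : hA.eigenvalues i₀ = k := by
    by_cases h : i₁ = i₀
    · exact h ▸ hi₁
    · exact absurd ((hi₀ i₁ h).trans hle) (not_le.2 (hi₁ ▸ hlam))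
  have hsplit (hle : secondEigenvalue H ≤ lam2) :
      P.eval (k : ℝ) * g.eval (k : ℝ) + ∑ i ∈ Finset.univ.erase i₀,
        P.eval (hA.eigenvalues i) * g.eval (hA.eigenvalues i) = ∑ u, ∑ v, Q u v * Y u v := by
    rw [← htrace, ← Finset.add_sum_erase _ _ (Finset.mem_univ i₀), hk₀ hle]
  have hothers (hle : secondEigenvalue H ≤ lam2) : ∀ i ∈ Finset.univ.erase i₀,
      P.eval (hA.eigenvalues i) * g.eval (hA.eigenvalues i) ≤ 0 := fun i hi =>
    hPg _ ((hi₀ i (Finset.ne_of_mem_erase hi)).trans hle)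
  have hlower : Fintype.card V * (c * g.eval (k : ℝ)) ≤ ∑ u, ∑ v, Q u v * Y u v := by
    calc _ = ∑ u : V, ∑ v, c * Y u v := by simp [hrow]
      _ ≤ _ := Finset.sum_le_sum fun u _ => Finset.sum_le_sum fun v _ => hentry u v
  have hM : c * Mbound k (n + 2) c = P.eval (k : ℝ) := Mbound_mul hc.ne' n
  refine ⟨?_, fun heq => le_antisymm ?_ hcard⟩
  · by_contra! hlt
    have hup : P.eval (k : ℝ) * g.eval (k : ℝ) ≤ Fintype.card V * (c * g.eval (k : ℝ)) := by
      rw [← hM]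
      nlinarith [mul_le_mul_of_nonneg_left hcard (mul_pos hc hgk).le]
    have hsum := Finset.sum_nonpos (hothers hlt.le)
    have hzero := (Finset.sum_eq_zero_iff_of_nonpos (hothers hlt.le)).1
      (by linarith [hsplit hlt.le])
    have hconst := aeval_apply_eq_of_eval_eq_zero hconn hreg hA g fun i => by
      by_cases hi : i = i₀
      · exact Or.inl (hi ▸ hk₀ hlt.le)
      · right
        have hlt' : hA.eigenvalues i - lam2 < 0 := by linarith [hi₀ i hi]
        have h := hzero i (Finset.mem_erase.2 ⟨hi, Finset.mem_univ i⟩)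
        have h2 : (hA.eigenvalues i - lam2) *
            (g.eval (hA.eigenvalues i) * g.eval (hA.eigenvalues i)) = 0 := by
          rw [← mul_assoc, hfactor, mul_assoc, h, mul_zero]
        simpa [hlt'.ne] using h2
    have hYpos (u v : V) : 0 < Y u v := by
      rw [hY, hconst u v v, ← hY, hYapply]
      refine Finset.sum_pos (fun i hi => mul_pos (hapos i hi) ?_) Finset.nonempty_range_add_one
      have := aeval_Gpoly_apply_mono hreg v v i.zero_le
      simp only [Gpoly_zero, map_one, Matrix.one_apply_eq] at this
      linarith
    have hQ_eq : ∀ u v, c * Y u v = Q u v * Y u v := by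
      have htot : ∑ u, ∑ v, c * Y u v = ∑ u, ∑ v, Q u v * Y u v := by
        simp only [hrow, Finset.sum_const, Finset.card_univ, nsmul_eq_mul]
        linarith [hsplit hlt.le]
      intro u v
      have h := (Finset.sum_eq_sum_iff_of_le
        fun u _ => Finset.sum_le_sum fun v _ => hentry u v).1 htot u (Finset.mem_univ u)
      exact (Finset.sum_eq_sum_iff_of_le fun v _ => hentry u v).1 h v (Finset.mem_univ v)
    have hF (u v : V) : aeval (H.adjMatrix ℝ) (Fpoly k (n + 1)) u v = 0 := by
      have h := mul_right_cancel₀ (hYpos u v).ne' (hQ_eq u v)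
      rw [hQapply] at h
      nlinarith [hGn u v (hYpos u v).ne', hFnonneg (n + 1) u v]
    have h := sum_aeval_adjMatrix_apply hreg (Fpoly k (n + 1)) (Classical.arbitrary V)
    simp only [hF, Finset.sum_const_zero, Fpoly_eval_self] at h
    have : 0 < (k : ℝ) * ((k : ℝ) - 1) ^ n := mul_pos (by linarith) (pow_pos hq n)
    linarith
  · have hsum := Finset.sum_nonpos (hothers heq.ge)
    have h : (c * g.eval (k : ℝ)) * Fintype.card V
        ≤ (c * g.eval (k : ℝ)) * Mbound k (n + 2) c := by
      have := hsplit heq.ge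
      rw [← hM] at this
      linarith
    exact le_of_mul_le_mul_left h (mul_pos hc hgk)
end

section
/- Let k ≥ 11 be an integer. Every connected k-regular finite simple graph G whose second largest adjacency eigenvalue satisfies λ₂(G) ≤ 1 has at most 2k+2 vertices, and equality holds if and only if G is isomorphic to the complement of the line graph of the complete bipartite graph K_{2,k+1}. -/
open Polynomial

/-- Vectors `w v` of squared norm `2` at height `1` with respect to `h`, orthogonal for adjacent
vertices and at inner product `1` for distinct nonadjacent vertices. -/
structure IsRootRepresentation {V E : Type*} [NormedAddCommGroup E] [InnerProductSpace ℝ E]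
    (G : SimpleGraph V) (w : V → E) (h : E) : Prop where
  inner_self (u : V) : inner ℝ (w u) (w u) = (2 : ℝ)
  inner_of_adj {u v : V} : G.Adj u v → inner ℝ (w u) (w v) = (0 : ℝ)
  inner_of_not_adj {u v : V} : u ≠ v → ¬ G.Adj u v → inner ℝ (w u) (w v) = (1 : ℝ)
  inner_height (u : V) : inner ℝ (w u) h = (1 : ℝ)

section Spectral

variable {V : Type*} [Fintype V] [DecidableEq V] (G : SimpleGraph V) [DecidableRel G.Adj]

theorem exists_forall_ne_eigenvalues_le {c : ℝ} (hcard : 2 ≤ Fintype.card V)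
    (h : secondEigenvalue G ≤ c) :
    ∃ i₀, ∀ i, i ≠ i₀ → (adjMatrix_isHermitian G).eigenvalues i ≤ c := by
  classical
  set l := (eigMultiset G).sort (· ≤ ·) with hl
  have hlen : l.length = Fintype.card V := by simp [hl, eigMultiset]
  have hsorted : l.Pairwise (· ≤ ·) := Multiset.pairwise_sort _ _
  have hget : l[l.length - 2]'(by omega) ≤ c := by
    have : secondEigenvalue G = l[l.length - 2]'(by omega) := by
      unfold secondEigenvalue
      rw [← hl]
      exact List.getD_eq_getElem _ _ _
    rwa [this] at h
  have htake : (l.take (l.length - 1)).countP (fun a => decide (c < a)) = 0 := by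
    rw [List.countP_eq_zero]
    intro a ha
    obtain ⟨i, hi, rfl⟩ := List.mem_iff_getElem.mp ha
    simp only [List.length_take] at hi
    simp only [List.getElem_take, decide_eq_true_eq, not_lt]
    refine le_trans ?_ hget
    rcases (show i ≤ l.length - 2 by omega).eq_or_lt with h | h
    · simp [h]
    · exact List.pairwise_iff_getElem.mp hsorted _ _ _ _ h
  have hcount : l.countP (fun a => decide (c < a)) ≤ 1 := by
    rw [← List.take_append_drop (l.length - 1) l, List.countP_append, htake, zero_add]
    refine List.countP_le_length.trans ?_
    simp only [List.length_drop]
    omega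
  have hms : (eigMultiset G).countP (fun a => c < a) ≤ 1 := by
    rw [← Multiset.sort_eq (eigMultiset G) (· ≤ ·), Multiset.coe_countP]
    exact hcount
  rw [eigMultiset, Multiset.countP_map] at hms
  have hcard1 : (Finset.univ.filter
      fun i => c < (adjMatrix_isHermitian G).eigenvalues i).card ≤ 1 := hms
  have : Nonempty V := Fintype.card_pos_iff.mp (by omega)
  obtain ⟨i₀, hi₀⟩ := Finset.card_le_one_iff_subset_singleton.mp hcard1
  refine ⟨i₀, fun i hi => ?_⟩
  by_contra! hlt
  exact hi (Finset.mem_singleton.mp (hi₀ (by simpa using hlt)))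

/-- Vectors orthogonal to the all-ones vector see only the eigenvalues other than the valency. -/
theorem dotProduct_adjMatrix_mulVec_le {k : ℕ} {c : ℝ} (hreg : G.IsRegularOfDegree k)
    (hcard : 2 ≤ Fintype.card V) (hck : c < k) (h : secondEigenvalue G ≤ c)
    (x : V → ℝ) (hx : ∑ v, x v = 0) :
    x ⬝ᵥ (G.adjMatrix ℝ).mulVec x ≤ c * (x ⬝ᵥ x) := by
  obtain ⟨i₀, hi₀⟩ := exists_forall_ne_eigenvalues_le G hcard h
  set hA := adjMatrix_isHermitian G
  set b := hA.eigenvectorBasis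
  have hdot (y z : EuclideanSpace ℝ V) : inner ℝ y z = (y : V → ℝ) ⬝ᵥ (z : V → ℝ) := by
    simp [PiLp.inner_apply, dotProduct, mul_comm]
  have hAb (i : V) (y : V → ℝ) :
      (b i : V → ℝ) ⬝ᵥ (G.adjMatrix ℝ).mulVec y = hA.eigenvalues i * ((b i : V → ℝ) ⬝ᵥ y) := by
    rw [Matrix.dotProduct_mulVec, ← Matrix.mulVec_transpose, G.transpose_adjMatrix,
      hA.mulVec_eigenvectorBasis, smul_dotProduct, smul_eq_mul]
  have hsum (y z : V → ℝ) :
      y ⬝ᵥ z = ∑ i, ((b i : V → ℝ) ⬝ᵥ y) * ((b i : V → ℝ) ⬝ᵥ z) := by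
    have := b.sum_inner_mul_inner (WithLp.toLp 2 y) (WithLp.toLp 2 z)
    simp only [hdot] at this
    rw [← this]
    exact Finset.sum_congr rfl fun i _ => by rw [dotProduct_comm y]
  have hone : (G.adjMatrix ℝ).mulVec (fun _ => 1) = (k : ℝ) • fun _ => (1 : ℝ) := by
    ext v
    simp [hreg v]
  have hzero (i : V) (hi : i ≠ i₀) : (b i : V → ℝ) ⬝ᵥ (fun _ => (1 : ℝ)) = 0 := by
    have := hAb i (fun _ => 1)
    rw [hone, dotProduct_smul, smul_eq_mul] at this
    have h2 : ((k : ℝ) - hA.eigenvalues i) * ((b i : V → ℝ) ⬝ᵥ (fun _ => (1 : ℝ))) = 0 := by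
      linarith
    refine (mul_eq_zero.mp h2).resolve_left ?_
    linarith [hi₀ i hi]
  have hprod (y : V → ℝ) : (fun _ => (1 : ℝ)) ⬝ᵥ y =
      ((b i₀ : V → ℝ) ⬝ᵥ fun _ => (1 : ℝ)) * ((b i₀ : V → ℝ) ⬝ᵥ y) := by
    rw [hsum]
    refine Finset.sum_eq_single i₀ (fun i _ hi => by rw [hzero i hi, zero_mul]) (by simp)
  have hx₀ : (b i₀ : V → ℝ) ⬝ᵥ x = 0 := by
    have h1 := hprod x
    have h2 := hprod (fun _ => 1)
    have h3 : (fun _ => (1 : ℝ)) ⬝ᵥ x = 0 := by simpa [dotProduct] using hx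
    rw [h3] at h1
    refine (mul_eq_zero.mp h1.symm).resolve_left fun h0 => ?_
    rw [h0] at h2
    simp [dotProduct] at h2
    omega
  rw [hsum x x, hsum x ((G.adjMatrix ℝ).mulVec x), Finset.mul_sum]
  refine Finset.sum_le_sum fun i _ => ?_
  rw [hAb]
  by_cases hi : i = i₀
  · rw [hi, hx₀]; simp
  · nlinarith [hi₀ i hi, mul_self_nonneg ((b i : V → ℝ) ⬝ᵥ x)]

open scoped MatrixOrder in
theorem exists_gram_vectors {M : Matrix V V ℝ} (hM : M.PosSemidef) :
    ∃ w : V → EuclideanSpace ℝ V, ∀ u v, inner ℝ (w u) (w v) = M u v := by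
  obtain ⟨B, rfl⟩ := CStarAlgebra.nonneg_iff_eq_star_mul_self.mp hM.nonneg
  refine ⟨fun v => WithLp.toLp 2 fun i => B i v, fun u v => ?_⟩
  simp [PiLp.inner_apply, Matrix.mul_apply, Matrix.star_eq_conjTranspose, mul_comm]

/-- The complement of a regular graph with second eigenvalue at most `1` has least eigenvalue at
least `-2`; it is represented by vectors of norm `2` lying in an affine hyperplane. -/
theorem exists_root_representation {k : ℕ} (hk : 2 ≤ k) (hreg : G.IsRegularOfDegree k)
    (hcard : 2 * k + 2 ≤ Fintype.card V) (hlam : secondEigenvalue G ≤ 1) :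
    ∃ (w : V → EuclideanSpace ℝ V) (h : EuclideanSpace ℝ V),
      IsRootRepresentation G w h ∧ inner ℝ h h < (2 : ℝ) := by
  set n : ℝ := (Fintype.card V : ℝ) with hn
  have hn2 : 2 * (k : ℝ) + 2 ≤ n := by rw [hn]; exact_mod_cast hcard
  have hk' : (2 : ℝ) ≤ k := by exact_mod_cast hk
  set M : Matrix V V ℝ := Matrix.of (fun _ _ => 1) + 1 - G.adjMatrix ℝ with hMdef
  have hMrow (v : V) : ∑ u, M v u = n + 1 - k := by
    simp only [hMdef, Matrix.sub_apply, Matrix.add_apply, Matrix.of_apply, Matrix.one_apply,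
      Finset.sum_sub_distrib, Finset.sum_add_distrib, G.adjMatrix_apply]
    simp [← hn, ← hreg v, ← G.card_neighborFinset_eq_degree, G.neighborFinset_eq_filter]
  have hquad (x : V → ℝ) : x ⬝ᵥ M.mulVec x =
      (∑ v, x v) ^ 2 + x ⬝ᵥ x - x ⬝ᵥ (G.adjMatrix ℝ).mulVec x := by
    rw [hMdef, Matrix.sub_mulVec, Matrix.add_mulVec, dotProduct_sub, dotProduct_add,
      Matrix.one_mulVec]
    congr 2
    simp [dotProduct, Matrix.mulVec, ← Finset.sum_mul, sq]
  have hsymm (u v : V) : M u v = M v u := by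
    simp [hMdef, Matrix.one_apply, eq_comm, G.adj_comm]
  have hM : M.PosSemidef := by
    refine .of_dotProduct_mulVec_nonneg ?_ fun x => ?_
    · ext u v
      simpa using hsymm v u
    · set μ := (∑ v, x v) / n with hμ
      have hnpos : 0 < n := by linarith
      set y : V → ℝ := fun v => x v - μ with hy
      have hysum : ∑ v, y v = 0 := by
        simp only [hy, Finset.sum_sub_distrib, Finset.sum_const, Finset.card_univ, nsmul_eq_mul]
        rw [← hn, hμ]
        field_simp
        ring
      have hle := dotProduct_adjMatrix_mulVec_le G hreg (by omega) (by linarith) hlam y hysum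
      have hxy : x = y + fun _ => μ := by ext v; simp [hy]
      have hMμ : M.mulVec (fun _ => μ) = fun _ => μ * (n + 1 - k) := by
        ext v
        simp only [Matrix.mulVec, dotProduct, ← Finset.sum_mul, hMrow]; ring
      have hMy : (fun _ => μ) ⬝ᵥ M.mulVec y = 0 := by
        have hMt : M.transpose = M := by ext u v; exact hsymm v u
        rw [Matrix.dotProduct_mulVec, ← Matrix.mulVec_transpose, hMt, hMμ]
        simp [dotProduct, ← Finset.mul_sum, hysum]
      have hyy := hquad y
      have hsx : star x = x := by ext; simp
      rw [hsx, hxy, Matrix.mulVec_add, add_dotProduct, dotProduct_add, dotProduct_add, hMy, hMμ]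
      have e1 : y ⬝ᵥ (fun _ => μ * (n + 1 - k)) = 0 := by
        simp [dotProduct, ← Finset.sum_mul, hysum]
      have e2 : (fun _ : V => μ) ⬝ᵥ (fun _ => μ * (n + 1 - k)) = n * (μ * μ) * (n + 1 - k) := by
        simp [dotProduct, ← hn]; ring
      rw [e1, e2, hyy, hysum]
      have : 0 ≤ n * (μ * μ) * (n + 1 - k) :=
        mul_nonneg (mul_nonneg hnpos.le (mul_self_nonneg _)) (by linarith)
      linarith
  obtain ⟨w, hw⟩ := exists_gram_vectors hM
  have hd : 0 < n + 1 - k := by linarith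
  have hwsum (u : V) : inner ℝ (w u) (∑ v, w v) = n + 1 - k := by
    simp [inner_sum, hw, hMrow]
  refine ⟨w, (n + 1 - k)⁻¹ • ∑ v, w v,
    ⟨fun u => ?_, fun {u v} huv => ?_, fun {u v} hne huv => ?_, fun u => ?_⟩, ?_⟩
  · rw [hw]; simp [hMdef]; norm_num
  · simp [hw, hMdef, huv, huv.ne]
  · simp [hw, hMdef, huv, hne]
  · rw [inner_smul_right, hwsum, inv_mul_cancel₀ hd.ne']
  · rw [inner_smul_right, inner_smul_left, sum_inner]
    simp only [hwsum, Finset.sum_const, Finset.card_univ, nsmul_eq_mul, ← hn]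
    simp only [map_inv₀, conj_trivial]
    field_simp
    linarith

end Spectral

namespace IsRootRepresentation

variable {V E : Type*} [NormedAddCommGroup E] [InnerProductSpace ℝ E]
  {G : SimpleGraph V} {w : V → E} {h : E}

theorem height_inner (hw : IsRootRepresentation G w h) (u : V) : inner ℝ h (w u) = (1 : ℝ) := by
  rw [real_inner_comm, hw.inner_height]

theorem exists_adj_of_triangle (hw : IsRootRepresentation G w h) (hh : inner ℝ h h < (2 : ℝ))
    {x y z u : V} (hxy : G.Adj x y) (hxz : G.Adj x z) (hyz : G.Adj y z)
    (hux : u ≠ x) (huy : u ≠ y) (huz : u ≠ z) : G.Adj u x ∨ G.Adj u y ∨ G.Adj u z := by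
  by_contra! hcon
  obtain ⟨h1, h2, h3⟩ := hcon
  have key := real_inner_self_nonneg (x := w u + h - (w x + w y + w z))
  simp only [inner_add_left, inner_add_right, inner_sub_left, inner_sub_right, hw.inner_self,
    hw.inner_height, hw.height_inner, hw.inner_of_adj hxy, hw.inner_of_adj hxz,
    hw.inner_of_adj hyz, hw.inner_of_adj hxy.symm, hw.inner_of_adj hxz.symm,
    hw.inner_of_adj hyz.symm, hw.inner_of_not_adj hux h1, hw.inner_of_not_adj huy h2,
    hw.inner_of_not_adj huz h3, hw.inner_of_not_adj hux.symm fun h => h1 h.symm,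
    hw.inner_of_not_adj huy.symm fun h => h2 h.symm,
    hw.inner_of_not_adj huz.symm fun h => h3 h.symm] at key
  linarith

theorem not_adj_of_triangle (hw : IsRootRepresentation G w h) (hh : inner ℝ h h < (2 : ℝ))
    {x y z u : V} (hxy : G.Adj x y) (hxz : G.Adj x z) (hyz : G.Adj y z) :
    ¬ (G.Adj u x ∧ G.Adj u y ∧ G.Adj u z) := by
  rintro ⟨h1, h2, h3⟩
  have key := real_inner_self_nonneg (x := w u - (2 : ℝ) • h + (w x + w y + w z))
  simp only [inner_add_left, inner_add_right, inner_sub_left, inner_sub_right,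
    real_inner_smul_left, real_inner_smul_right, hw.inner_self,
    hw.inner_height, hw.height_inner, hw.inner_of_adj hxy, hw.inner_of_adj hxz,
    hw.inner_of_adj hyz, hw.inner_of_adj hxy.symm, hw.inner_of_adj hxz.symm,
    hw.inner_of_adj hyz.symm, hw.inner_of_adj h1, hw.inner_of_adj h2, hw.inner_of_adj h3,
    hw.inner_of_adj h1.symm, hw.inner_of_adj h2.symm, hw.inner_of_adj h3.symm] at key
  linarith

end IsRootRepresentation

theorem sq_mul_card_le_inner_self {ι E : Type*} [NormedAddCommGroup E] [InnerProductSpace ℝ E]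
    (s : Finset ι) (e : ι → E) (q : E) (ε : ℝ) (hself : ∀ i ∈ s, inner ℝ (e i) (e i) = (1 : ℝ))
    (horth : ∀ i ∈ s, ∀ j ∈ s, i ≠ j → inner ℝ (e i) (e j) = (0 : ℝ))
    (hq : ∀ i ∈ s, inner ℝ (e i) q = ε) : ε ^ 2 * s.card ≤ inner ℝ q q := by
  classical
  have h1 : inner ℝ (∑ i ∈ s, e i) q = s.card * ε := by
    rw [sum_inner, Finset.sum_congr rfl hq]; simp
  have h2 : inner ℝ (∑ i ∈ s, e i) (∑ i ∈ s, e i) = (s.card : ℝ) := by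
    have (i) (hi : i ∈ s) : ∑ j ∈ s, inner ℝ (e i) (e j) = (1 : ℝ) := by
      rw [Finset.sum_eq_single_of_mem i hi fun j hj hne => horth i hi j hj hne.symm, hself i hi]
    simp_rw [sum_inner, inner_sum]
    rw [Finset.sum_congr rfl this]; simp
  have key := real_inner_self_nonneg (x := q - ε • ∑ i ∈ s, e i)
  simp only [inner_sub_left, inner_sub_right, real_inner_smul_left, real_inner_smul_right,
    real_inner_comm (∑ i ∈ s, e i) q, h1, h2] at key
  linarith

section Triangle

variable {V E : Type*} [NormedAddCommGroup E] [InnerProductSpace ℝ E] [Fintype V]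
  {G : SimpleGraph V} [DecidableRel G.Adj] {w : V → E} {h : E}

/-- The vertices adjacent to `x` but to neither `y` nor `z`. -/
def privateNeighbors (G : SimpleGraph V) [DecidableRel G.Adj] (x y z : V) : Finset V :=
  Finset.univ.filter fun u => G.Adj u x ∧ ¬ G.Adj u y ∧ ¬ G.Adj u z

/-- The common neighbours of `y` and `z` not adjacent to `x` and distinct from `x`. -/
def sharedNeighbors [DecidableEq V] (G : SimpleGraph V) [DecidableRel G.Adj] (x y z : V) :
    Finset V :=
  Finset.univ.filter fun u => u ≠ x ∧ ¬ G.Adj u x ∧ G.Adj u y ∧ G.Adj u z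

theorem privateNeighbors_comm (x y z : V) :
    privateNeighbors G x y z = privateNeighbors G x z y := by
  ext u
  simp only [privateNeighbors, Finset.mem_filter, Finset.mem_univ, true_and]
  tauto

theorem sharedNeighbors_comm [DecidableEq V] (x y z : V) :
    sharedNeighbors G x y z = sharedNeighbors G x z y := by
  ext u
  simp only [sharedNeighbors, Finset.mem_filter, Finset.mem_univ, true_and]
  tauto

theorem card_privateNeighbors_le_aux (hw : IsRootRepresentation G w h) {x y z c : V}
    (hxy : G.Adj x y) (hxz : G.Adj x z) (hyz : G.Adj y z)
    (hc : c ∈ privateNeighbors G y x z) (q : E)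
    (hq : ∀ u ∈ privateNeighbors G x y z, inner ℝ (w u - (1 / 2 : ℝ) • (w y + w z)) q =
      inner ℝ (w u) (w c) - 1 / 2) :
    ∃ p m : ℕ, (privateNeighbors G x y z).card = p + m ∧
      (p : ℝ) ≤ 4 * inner ℝ q q ∧ (m : ℝ) ≤ 4 * inner ℝ q q := by
  simp only [privateNeighbors, Finset.mem_filter, Finset.mem_univ, true_and] at hc
  obtain ⟨hcy, hcx, hcz⟩ := hc
  set e : V → E := fun u => w u - (1 / 2 : ℝ) • (w y + w z) with he
  set f : E := w c - (1 / 2 : ℝ) • (w x + w z) with hf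
  set C := privateNeighbors G x y z with hC
  have hmem (u : V) (hu : u ∈ C) : G.Adj u x ∧ ¬ G.Adj u y ∧ ¬ G.Adj u z ∧ u ≠ y ∧ u ≠ z ∧
      u ≠ c := by
    simp only [hC, privateNeighbors, Finset.mem_filter, Finset.mem_univ, true_and] at hu
    refine ⟨hu.1, hu.2.1, hu.2.2, ?_, ?_, ?_⟩
    · rintro rfl; exact hu.2.2 hyz
    · rintro rfl; exact hu.2.1 hyz.symm
    · rintro rfl; exact hcx hu.1
  have hee (u v : V) (hu : u ∈ C) (hv : v ∈ C) :
      inner ℝ (e u) (e v) = inner ℝ (w u) (w v) - 1 := by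
    obtain ⟨-, huy, huz, huy', huz', -⟩ := hmem u hu
    obtain ⟨-, hvy, hvz, hvy', hvz', -⟩ := hmem v hv
    simp only [he, inner_add_left, inner_add_right, inner_sub_left, inner_sub_right,
      real_inner_smul_left, real_inner_smul_right, hw.inner_self, hw.inner_of_adj hyz,
      hw.inner_of_adj hyz.symm, hw.inner_of_not_adj huy' huy, hw.inner_of_not_adj huz' huz,
      hw.inner_of_not_adj hvy'.symm fun h => hvy h.symm,
      hw.inner_of_not_adj hvz'.symm fun h => hvz h.symm]
    ring
  have hcz' : c ≠ z := by rintro rfl; exact hcx hxz.symm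
  have hcx' : c ≠ x := by rintro rfl; exact hcz hxz
  have hef (u : V) (hu : u ∈ C) : inner ℝ (e u) f = inner ℝ (w u) (w c) - 1 / 2 := by
    obtain ⟨hux, huy, huz, huy', huz', -⟩ := hmem u hu
    simp only [he, hf, inner_add_left, inner_add_right, inner_sub_left, inner_sub_right,
      real_inner_smul_left, real_inner_smul_right, hw.inner_self, hw.inner_of_adj hyz,
      hw.inner_of_adj hxz.symm, hw.inner_of_adj hxy.symm, hw.inner_of_adj hux,
      hw.inner_of_adj hcy.symm, hw.inner_of_not_adj huz' huz,
      hw.inner_of_not_adj hcz'.symm fun h => hcz h.symm]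
    ring
  have hff : inner ℝ f f = (1 : ℝ) := by
    simp only [hf, inner_add_left, inner_add_right, inner_sub_left, inner_sub_right,
      real_inner_smul_left, real_inner_smul_right, hw.inner_self, hw.inner_of_adj hxz,
      hw.inner_of_adj hxz.symm, hw.inner_of_not_adj hcz' hcz, hw.inner_of_not_adj hcx' hcx,
      hw.inner_of_not_adj hcz'.symm fun h => hcz h.symm,
      hw.inner_of_not_adj hcx'.symm fun h => hcx h.symm]
    ring
  have horth (ε : ℝ) (hε : ε ^ 2 = 1 / 4) (u v : V) (hu : u ∈ C) (hv : v ∈ C) (hne : u ≠ v)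
      (hu' : inner ℝ (e u) f = ε) (hv' : inner ℝ (e v) f = ε) : inner ℝ (e u) (e v) = (0 : ℝ) := by
    by_cases huv : G.Adj u v
    · exfalso
      have key := real_inner_self_nonneg (x := e u + e v - (2 * ε) • f)
      simp only [inner_add_left, inner_add_right, inner_sub_left, inner_sub_right,
        real_inner_smul_left, real_inner_smul_right, hee _ _ hu hu, hee _ _ hv hv,
        hee _ _ hu hv, hee _ _ hv hu, hw.inner_self, hw.inner_of_adj huv,
        hw.inner_of_adj huv.symm, hu', hv', hff, real_inner_comm (e u) f,
        real_inner_comm (e v) f] at key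
      nlinarith
    · rw [hee _ _ hu hv, hw.inner_of_not_adj hne huv]; ring
  have hbound (s : Finset V) (hs : s ⊆ C) (ε : ℝ) (hε : ε ^ 2 = 1 / 4)
      (hsε : ∀ u ∈ s, inner ℝ (w u) (w c) - 1 / 2 = ε) : (s.card : ℝ) ≤ 4 * inner ℝ q q := by
    have := sq_mul_card_le_inner_self s e q ε
      (fun u hu => by rw [hee _ _ (hs hu) (hs hu), hw.inner_self]; ring)
      (fun u hu v hv hne => horth ε hε u v (hs hu) (hs hv) hne
        (by rw [hef u (hs hu), hsε u hu]) (by rw [hef v (hs hv), hsε v hv]))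
      (fun u hu => by rw [← hsε u hu]; exact hq u (hs hu))
    rw [hε] at this
    linarith
  refine ⟨_, _, (Finset.card_filter_add_card_filter_not (s := C) (fun u => G.Adj u c)).symm,
    hbound _ (Finset.filter_subset _ _) (-1 / 2) (by norm_num) fun u hu => ?_,
    hbound _ (Finset.filter_subset _ _) (1 / 2) (by norm_num) fun u hu => ?_⟩
  · rw [Finset.mem_filter] at hu
    rw [hw.inner_of_adj hu.2]; norm_num
  · rw [Finset.mem_filter] at hu
    rw [hw.inner_of_not_adj (hmem u hu.1).2.2.2.2.2 hu.2]; norm_num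

theorem card_privateNeighbors_le [DecidableEq V] (hw : IsRootRepresentation G w h)
    (hh : inner ℝ h h < (2 : ℝ)) {x y z : V}
    (hxy : G.Adj x y) (hxz : G.Adj x z) (hyz : G.Adj y z)
    (hne : (privateNeighbors G y x z).Nonempty) :
    (privateNeighbors G x y z).card ≤ 8 ∧
      ((sharedNeighbors G x y z).Nonempty → (privateNeighbors G x y z).card ≤ 4) := by
  obtain ⟨c, hc⟩ := hne
  have hc0 := hc
  simp only [privateNeighbors, Finset.mem_filter, Finset.mem_univ, true_and] at hc
  obtain ⟨hcy, hcx, hcz⟩ := hc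
  have hcz' : c ≠ z := by rintro rfl; exact hcx hxz.symm
  have hcx' : c ≠ x := by rintro rfl; exact hcz hxz
  set e : V → E := fun u => w u - (1 / 2 : ℝ) • (w y + w z) with he
  set f : E := w c - (1 / 2 : ℝ) • (w x + w z) with hf
  set C := privateNeighbors G x y z with hC
  have hmem (u : V) (hu : u ∈ C) : G.Adj u x ∧ ¬ G.Adj u y ∧ ¬ G.Adj u z ∧ u ≠ y ∧ u ≠ z := by
    simp only [hC, privateNeighbors, Finset.mem_filter, Finset.mem_univ, true_and] at hu
    refine ⟨hu.1, hu.2.1, hu.2.2, ?_, ?_⟩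
    · rintro rfl; exact hu.2.2 hyz
    · rintro rfl; exact hu.2.1 hyz.symm
  have hef (u : V) (hu : u ∈ C) : inner ℝ (e u) f = inner ℝ (w u) (w c) - 1 / 2 := by
    obtain ⟨hux, huy, huz, huy', huz'⟩ := hmem u hu
    simp only [he, hf, inner_add_left, inner_add_right, inner_sub_left, inner_sub_right,
      real_inner_smul_left, real_inner_smul_right, hw.inner_self, hw.inner_of_adj hyz,
      hw.inner_of_adj hxz.symm, hw.inner_of_adj hxy.symm, hw.inner_of_adj hux,
      hw.inner_of_adj hcy.symm, hw.inner_of_not_adj huz' huz,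
      hw.inner_of_not_adj hcz'.symm fun h => hcz h.symm]
    ring
  have hff : inner ℝ f f = (1 : ℝ) := by
    simp only [hf, inner_add_left, inner_add_right, inner_sub_left, inner_sub_right,
      real_inner_smul_left, real_inner_smul_right, hw.inner_self, hw.inner_of_adj hxz,
      hw.inner_of_adj hxz.symm, hw.inner_of_not_adj hcz' hcz, hw.inner_of_not_adj hcx' hcx,
      hw.inner_of_not_adj hcz'.symm fun h => hcz h.symm,
      hw.inner_of_not_adj hcx'.symm fun h => hcx h.symm]
    ring
  constructor
  · obtain ⟨p, m, hpm, hp, hm⟩ := card_privateNeighbors_le_aux hw hxy hxz hyz hc0 f hef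
    rw [hff] at hp hm
    norm_num at hp hm
    have hp4 : p ≤ 4 := by exact_mod_cast hp
    have hm4 : m ≤ 4 := by exact_mod_cast hm
    rw [← hC] at hpm
    omega
  rintro ⟨d, hd⟩
  simp only [sharedNeighbors, Finset.mem_filter, Finset.mem_univ, true_and] at hd
  obtain ⟨hdx', hdx, hdy, hdz⟩ := hd
  set g : E := w d - h + (1 / 2 : ℝ) • (w y + w z) with hg
  have hgg : inner ℝ g g = inner ℝ h h - (1 : ℝ) := by
    simp only [hg, inner_add_left, inner_add_right, inner_sub_left, inner_sub_right,
      real_inner_smul_left, real_inner_smul_right, hw.inner_self, hw.inner_of_adj hyz,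
      hw.inner_height, hw.height_inner, hw.inner_of_adj hyz.symm, hw.inner_of_adj hdy,
      hw.inner_of_adj hdz, hw.inner_of_adj hdy.symm, hw.inner_of_adj hdz.symm]
    ring
  have heg' (u : V) (hu : u ∈ C) : inner ℝ (e u) g = inner ℝ (w u) (w d) := by
    obtain ⟨hux, huy, huz, huy', huz'⟩ := hmem u hu
    simp only [he, hg, inner_add_left, inner_add_right, inner_sub_left, inner_sub_right,
      real_inner_smul_left, real_inner_smul_right, hw.inner_self, hw.inner_of_adj hyz,
      hw.inner_of_adj hyz.symm, hw.inner_height, hw.inner_of_adj hdy.symm,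
      hw.inner_of_adj hdz.symm, hw.inner_of_not_adj huz' huz, hw.inner_of_not_adj huy' huy]
    ring
  have heg (u : V) (hu : u ∈ C) : inner ℝ (e u) g = (0 : ℝ) := by
    obtain ⟨hux, huy, huz, huy', huz'⟩ := hmem u hu
    have hud : u ≠ d := by rintro rfl; exact hdx hux
    by_cases hadj : G.Adj u d
    · rw [heg' u hu, hw.inner_of_adj hadj]
    · exfalso
      have heu : inner ℝ (e u) (e u) = (1 : ℝ) := by
        simp only [he, inner_add_left, inner_add_right, inner_sub_left, inner_sub_right,
          real_inner_smul_left, real_inner_smul_right, hw.inner_self, hw.inner_of_adj hyz,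
          hw.inner_of_adj hyz.symm, hw.inner_of_not_adj huy' huy, hw.inner_of_not_adj huz' huz,
          hw.inner_of_not_adj huy'.symm fun h => huy h.symm,
          hw.inner_of_not_adj huz'.symm fun h => huz h.symm]
        ring
      have h1 := heg' u hu
      rw [hw.inner_of_not_adj hud hadj] at h1
      have key := real_inner_self_nonneg (x := e u - g)
      rw [real_inner_sub_sub_self, h1, heu, hgg] at key
      linarith
  have hfg : inner ℝ f g ^ 2 = (1 / 4 : ℝ) := by
    have : inner ℝ f g = inner ℝ (w c) (w d) - 1 / 2 := by
      simp only [hf, hg, inner_add_left, inner_add_right, inner_sub_left, inner_sub_right,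
        real_inner_smul_left, real_inner_smul_right, hw.inner_self, hw.inner_of_adj hyz.symm,
        hw.inner_height, hw.inner_of_adj hdz.symm, hw.inner_of_adj hcy, hw.inner_of_adj hxy,
        hw.inner_of_adj hxz, hw.inner_of_not_adj hcz' hcz,
        hw.inner_of_not_adj hdx'.symm fun h => hdx h.symm]
      ring
    have hcd : c ≠ d := by rintro rfl; exact hcz hdz
    by_cases hadj : G.Adj c d
    · rw [this, hw.inner_of_adj hadj]; norm_num
    · rw [this, hw.inner_of_not_adj hcd hadj]; norm_num
  set τ := inner ℝ f g with hτ
  have hqq : inner ℝ (f - τ • g) (f - τ • g) = 1 / 4 + inner ℝ h h / (4 : ℝ) := by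
    simp only [inner_sub_left, inner_sub_right, real_inner_smul_left, real_inner_smul_right, hff,
      hgg, real_inner_comm f g, ← hτ]
    nlinarith
  obtain ⟨p, m, hpm, hp, hm⟩ := card_privateNeighbors_le_aux hw hxy hxz hyz hc0 (f - τ • g)
    fun u hu => by
      rw [inner_sub_right, real_inner_smul_right]
      have h1 := heg u hu
      have h2 := hef u hu
      simp only [he] at h1 h2
      rw [h1, h2]; ring
  rw [hqq] at hp hm
  have hp3 : p < 3 := by
    have : (p : ℝ) < 3 := by linarith
    exact_mod_cast this
  have hm3 : m < 3 := by
    have : (m : ℝ) < 3 := by linarith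
    exact_mod_cast this
  rw [← hC] at hpm
  omega

end Triangle

section TriangleFree

variable {V E : Type*} [NormedAddCommGroup E] [InnerProductSpace ℝ E] [Fintype V]
  [DecidableEq V] {G : SimpleGraph V} [DecidableRel G.Adj] {w : V → E} {h : E}

theorem degree_eq_of_triangle {x y z : V} (hxy : G.Adj x y) (hxz : G.Adj x z) (hyz : G.Adj y z)
    (hnot : ∀ u, ¬ (G.Adj u x ∧ G.Adj u y ∧ G.Adj u z)) :
    G.degree x = 2 + (privateNeighbors G x y z).card + (sharedNeighbors G y x z).card +
      (sharedNeighbors G z x y).card := by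
  have hpair : ({y, z} : Finset V).card = 2 := Finset.card_pair hyz.ne
  have hunion : G.neighborFinset x = {y, z} ∪ (privateNeighbors G x y z ∪
      (sharedNeighbors G y x z ∪ sharedNeighbors G z x y)) := by
    ext u
    have := hnot u
    have hyx := hxy.symm
    have hzx := hxz.symm
    simp only [SimpleGraph.mem_neighborFinset, privateNeighbors, sharedNeighbors,
      Finset.mem_union, Finset.mem_insert, Finset.mem_singleton, Finset.mem_filter,
      Finset.mem_univ, true_and, G.adj_comm x u]
    grind
  rw [← G.card_neighborFinset_eq_degree, hunion, Finset.card_union_of_disjoint,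
    Finset.card_union_of_disjoint, Finset.card_union_of_disjoint, hpair]
  · ring
  all_goals
    rw [Finset.disjoint_left]
    intro u
    have hzy := hyz.symm
    have hyx := hxy.symm
    simp only [privateNeighbors, sharedNeighbors, Finset.mem_union, Finset.mem_insert,
      Finset.mem_singleton, Finset.mem_filter, Finset.mem_univ, true_and]
    grind

theorem card_le_of_triangle {x y z : V}
    (hsome : ∀ u, u ≠ x → u ≠ y → u ≠ z → G.Adj u x ∨ G.Adj u y ∨ G.Adj u z)
    (hnot : ∀ u, ¬ (G.Adj u x ∧ G.Adj u y ∧ G.Adj u z)) :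
    Fintype.card V ≤ 3 + (privateNeighbors G x y z).card + (privateNeighbors G y x z).card +
      (privateNeighbors G z x y).card + (sharedNeighbors G x y z).card +
      (sharedNeighbors G y x z).card + (sharedNeighbors G z x y).card := by
  have hunion : (Finset.univ : Finset V) = {x, y, z} ∪ (privateNeighbors G x y z ∪
      (privateNeighbors G y x z ∪ (privateNeighbors G z x y ∪ (sharedNeighbors G x y z ∪
      (sharedNeighbors G y x z ∪ sharedNeighbors G z x y))))) := by
    ext u
    have := hnot u
    have := hsome u
    simp only [privateNeighbors, sharedNeighbors,
      Finset.mem_union, Finset.mem_insert, Finset.mem_singleton, Finset.mem_filter,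
      Finset.mem_univ, true_and]
    grind
  rw [← Finset.card_univ, hunion]
  have h3 : ({x, y, z} : Finset V).card ≤ 3 := Finset.card_le_three
  refine (Finset.card_union_le _ _).trans ?_
  have h1 := Finset.card_union_le (privateNeighbors G x y z)
    (privateNeighbors G y x z ∪ (privateNeighbors G z x y ∪ (sharedNeighbors G x y z ∪
      (sharedNeighbors G y x z ∪ sharedNeighbors G z x y))))
  have h2 := Finset.card_union_le (privateNeighbors G y x z)
    (privateNeighbors G z x y ∪ (sharedNeighbors G x y z ∪
      (sharedNeighbors G y x z ∪ sharedNeighbors G z x y)))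
  have h4 := Finset.card_union_le (privateNeighbors G z x y)
    (sharedNeighbors G x y z ∪ (sharedNeighbors G y x z ∪ sharedNeighbors G z x y))
  have h5 := Finset.card_union_le (sharedNeighbors G x y z)
    (sharedNeighbors G y x z ∪ sharedNeighbors G z x y)
  have h6 := Finset.card_union_le (sharedNeighbors G y x z) (sharedNeighbors G z x y)
  omega

namespace IsRootRepresentation

theorem not_triangle (hw : IsRootRepresentation G w h) (hh : inner ℝ h h < (2 : ℝ)) {k : ℕ}
    (hk : 11 ≤ k) (hreg : G.IsRegularOfDegree k) (hcard : 2 * k + 2 ≤ Fintype.card V)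
    {x y z : V} (hxy : G.Adj x y) (hxz : G.Adj x z) (hyz : G.Adj y z) : False := by
  have hnot (u : V) := hw.not_adj_of_triangle hh (u := u) hxy hxz hyz
  have hx := degree_eq_of_triangle hxy hxz hyz hnot
  have hy := degree_eq_of_triangle hxy.symm hyz hxz fun u hu => hnot u ⟨hu.2.1, hu.1, hu.2.2⟩
  have hz := degree_eq_of_triangle hxz.symm hyz.symm hxy fun u hu => hnot u ⟨hu.2.1, hu.2.2, hu.1⟩
  have hn := card_le_of_triangle
    (fun u hux huy huz => hw.exists_adj_of_triangle hh hxy hxz hyz hux huy huz) hnot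
  rw [hreg x] at hx
  rw [hreg y, sharedNeighbors_comm z y x] at hy
  rw [hreg z, sharedNeighbors_comm x z y, sharedNeighbors_comm y z x] at hz
  have hCx : (privateNeighbors G x y z).Nonempty := Finset.card_pos.mp (by omega)
  have hCy : (privateNeighbors G y x z).Nonempty := Finset.card_pos.mp (by omega)
  obtain ⟨hx_le, hx_pos⟩ := card_privateNeighbors_le hw hh hxy hxz hyz hCy
  obtain ⟨hy_le, hy_pos⟩ := card_privateNeighbors_le hw hh hxy.symm hyz hxz hCx
  obtain ⟨hz_le, hz_pos⟩ := card_privateNeighbors_le hw hh hxz.symm hyz.symm hxy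
    (privateNeighbors_comm (G := G) x y z ▸ hCx)
  rw [← Finset.card_pos] at hx_pos hy_pos hz_pos
  omega

theorem card_common_neighbors (hw : IsRootRepresentation G w h) {k : ℕ} (hk : 8 ≤ k)
    (hreg : G.IsRegularOfDegree k)
    (hfree : ∀ x y z, G.Adj x y → G.Adj x z → ¬ G.Adj y z) {v z : V} (hne : z ≠ v)
    (hadj : ¬ G.Adj z v) {c : V} (hcv : G.Adj v c) (hcz : G.Adj z c) :
    k ≤ (G.neighborFinset v ∩ G.neighborFinset z).card + 1 := by
  set T := G.neighborFinset v ∩ G.neighborFinset z with hT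
  set P := G.neighborFinset v \ G.neighborFinset z with hP
  have hsum : T.card + P.card = k := by
    rw [hT, hP, Finset.card_inter_add_card_sdiff, G.card_neighborFinset_eq_degree, hreg v]
  have hTmem (s : V) (hs : s ∈ T) : G.Adj v s ∧ G.Adj z s := by simpa [hT] using hs
  have hPmem (s : V) (hs : s ∈ P) : G.Adj v s ∧ ¬ G.Adj z s := by simpa [hP] using hs
  have hTpos : 0 < T.card := Finset.card_pos.mpr ⟨c, by simp [hT, hcv, hcz]⟩
  by_contra! hlt
  have hST (s t : V) (hs : G.Adj v s) (ht : G.Adj v t) :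
      inner ℝ (w s) (w t) = (1 : ℝ) + if s = t then 1 else 0 := by
    split_ifs with hst
    · rw [hst, hw.inner_self]; norm_num
    · rw [hw.inner_of_not_adj hst (hfree v s t hs ht)]; norm_num
  set q : E := w z - (1 / 2 : ℝ) • w v with hq
  have hqq : inner ℝ q q = (3 / 2 : ℝ) := by
    simp only [hq, inner_sub_left, inner_sub_right, real_inner_smul_left, real_inner_smul_right,
      hw.inner_self, hw.inner_of_not_adj hne hadj,
      hw.inner_of_not_adj hne.symm fun h => hadj h.symm]
    norm_num
  have hqT : inner ℝ q (∑ s ∈ T, w s) = (0 : ℝ) := by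
    rw [inner_sum]
    refine Finset.sum_eq_zero fun s hs => ?_
    rw [hq, inner_sub_left, real_inner_smul_left, hw.inner_of_adj (hTmem s hs).1,
      hw.inner_of_adj (hTmem s hs).2]
    norm_num
  have hqP : inner ℝ q (∑ s ∈ P, w s) = (P.card : ℝ) := by
    rw [inner_sum, Finset.sum_congr rfl (g := fun _ => (1 : ℝ))]
    · simp
    intro s hs
    have hzs : z ≠ s := by rintro rfl; exact hadj (hPmem z hs).1.symm
    rw [hq, inner_sub_left, real_inner_smul_left, hw.inner_of_adj (hPmem s hs).1,
      hw.inner_of_not_adj hzs (hPmem s hs).2]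
    norm_num
  have hself (A : Finset V) (hA : ∀ s ∈ A, G.Adj v s) :
      inner ℝ (∑ s ∈ A, w s) (∑ s ∈ A, w s) = (A.card : ℝ) * (A.card + 1) := by
    simp_rw [sum_inner, inner_sum]
    rw [Finset.sum_congr rfl (g := fun _ => (A.card : ℝ) + 1)]
    · simp [mul_add]
    intro s hs
    rw [Finset.sum_congr rfl fun t ht => hST s t (hA s hs) (hA t ht)]
    simp [Finset.sum_add_distrib, hs]
  have hTP : inner ℝ (∑ s ∈ T, w s) (∑ s ∈ P, w s) = (T.card : ℝ) * P.card := by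
    simp_rw [sum_inner, inner_sum]
    rw [Finset.sum_congr rfl (g := fun _ => (P.card : ℝ))]
    · simp
    intro s hs
    rw [Finset.sum_congr rfl fun t ht => hST s t (hTmem s hs).1 (hPmem t ht).1]
    have : s ∉ P := fun h => (hPmem s h).2 (hTmem s hs).2
    simp [Finset.sum_add_distrib, this]
  have hTT := hself T fun s hs => (hTmem s hs).1
  have hPP := hself P fun s hs => (hPmem s hs).1
  set t : ℝ := (T.card : ℝ) with ht
  set r : ℝ := (P.card : ℝ) with hr
  have ht1 : 1 ≤ t := by rw [ht]; exact_mod_cast hTpos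
  have hr2 : 2 ≤ r := by
    have : 2 ≤ P.card := by omega
    rw [hr]; exact_mod_cast this
  have hK : 8 ≤ t + r := by
    have : 8 ≤ T.card + P.card := by omega
    rw [ht, hr]; exact_mod_cast this
  have key := real_inner_self_nonneg
    (x := (r + t + 1) • q - (t + 1) • (∑ s ∈ P, w s) + r • (∑ s ∈ T, w s))
  simp only [inner_add_left, inner_add_right, inner_sub_left, inner_sub_right,
    real_inner_smul_left, real_inner_smul_right, hqq, hqT, hqP, hTT, hPP, hTP,
    real_inner_comm q (∑ s ∈ P, w s), real_inner_comm q (∑ s ∈ T, w s),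
    real_inner_comm (∑ s ∈ T, w s) (∑ s ∈ P, w s)] at key
  have hmul : 0 ≤ (r + t + 1) * (3 / 2 * (r + t + 1) - r * (t + 1)) := by linarith
  have hpos : 0 < r + t + 1 := by linarith
  have := nonneg_of_mul_nonneg_right hmul hpos
  nlinarith [mul_nonneg (sub_nonneg.mpr hr2) (sub_nonneg.mpr ht1)]

end IsRootRepresentation

end TriangleFree

section Bipartite

variable {V : Type*} [Fintype V] {G : SimpleGraph V} [DecidableRel G.Adj] {k : ℕ}

/-- The vertices which have a common neighbour with `v`. -/
def evenClass (G : SimpleGraph V) [DecidableRel G.Adj] (v : V) : Finset V :=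
  Finset.univ.filter fun u => ∃ c, G.Adj u c ∧ G.Adj v c

theorem mem_evenClass {u v : V} : u ∈ evenClass G v ↔ ∃ c, G.Adj u c ∧ G.Adj v c := by
  simp [evenClass]

variable [DecidableEq V]

theorem evenClass_trans (hk : 3 ≤ k) (hreg : G.IsRegularOfDegree k)
    (hcommon : ∀ v, ∀ z ∈ evenClass G v, z ≠ v →
      k ≤ (G.neighborFinset v ∩ G.neighborFinset z).card + 1)
    {u v z : V} (huv : u ∈ evenClass G v) (hvz : v ∈ evenClass G z) : u ∈ evenClass G z := by
  rcases eq_or_ne u v with rfl | huv'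
  · exact hvz
  rcases eq_or_ne z v with rfl | hzv'
  · exact huv
  have h1 := hcommon v u huv huv'
  have h2 := hcommon v z (by simpa [mem_evenClass, and_comm] using hvz) hzv'
  have hsub : (G.neighborFinset v ∩ G.neighborFinset u) ∪
      (G.neighborFinset v ∩ G.neighborFinset z) ⊆ G.neighborFinset v :=
    Finset.union_subset Finset.inter_subset_left Finset.inter_subset_left
  have h3 := Finset.card_le_card hsub
  rw [G.card_neighborFinset_eq_degree, hreg v] at h3
  have h4 := Finset.card_union_add_card_inter (G.neighborFinset v ∩ G.neighborFinset u)
    (G.neighborFinset v ∩ G.neighborFinset z)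
  obtain ⟨c, hc⟩ := Finset.card_pos.mp (show 0 < ((G.neighborFinset v ∩ G.neighborFinset u) ∩
    (G.neighborFinset v ∩ G.neighborFinset z)).card by omega)
  simp only [Finset.mem_inter, SimpleGraph.mem_neighborFinset] at hc
  exact mem_evenClass.mpr ⟨c, hc.1.2, hc.2.2⟩

theorem card_evenClass_le (hk : 2 ≤ k) (hreg : G.IsRegularOfDegree k)
    (hcommon : ∀ v, ∀ z ∈ evenClass G v, z ≠ v →
      k ≤ (G.neighborFinset v ∩ G.neighborFinset z).card + 1) (v : V) :
    (evenClass G v).card ≤ k + 1 := by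
  have hcount := Finset.sum_card_bipartiteAbove_eq_sum_card_bipartiteBelow
    (s := evenClass G v) (t := G.neighborFinset v) G.Adj
  have habove (a : V) : Finset.bipartiteAbove G.Adj (G.neighborFinset v) a =
      G.neighborFinset v ∩ G.neighborFinset a := by
    ext c; simp [Finset.bipartiteAbove]
  have hbelow (b : V) (hb : b ∈ G.neighborFinset v) :
      (Finset.bipartiteBelow G.Adj (evenClass G v) b).card = k := by
    rw [← hreg b, ← G.card_neighborFinset_eq_degree]
    congr 1
    ext c
    simp only [Finset.mem_bipartiteBelow, mem_evenClass, SimpleGraph.mem_neighborFinset] at hb ⊢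
    exact ⟨fun h => h.2.symm, fun h => ⟨⟨b, h.symm, hb⟩, h.symm⟩⟩
  rw [Finset.sum_congr rfl hbelow, Finset.sum_const, G.card_neighborFinset_eq_degree, hreg v,
    smul_eq_mul] at hcount
  obtain ⟨c, hc⟩ := Finset.card_pos.mp
    (show 0 < (G.neighborFinset v).card by rw [G.card_neighborFinset_eq_degree, hreg v]; omega)
  rw [SimpleGraph.mem_neighborFinset] at hc
  have hv : v ∈ evenClass G v := mem_evenClass.mpr ⟨c, hc, hc⟩
  rw [← Finset.add_sum_erase _ _ hv, habove, Finset.inter_self, G.card_neighborFinset_eq_degree,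
    hreg v] at hcount
  have hle := Finset.card_nsmul_le_sum ((evenClass G v).erase v)
    (fun a => (Finset.bipartiteAbove G.Adj (G.neighborFinset v) a).card) (k - 1) fun a ha => by
      have := hcommon v a (Finset.mem_of_mem_erase ha) (Finset.ne_of_mem_erase ha)
      rw [habove]
      omega
  rw [Finset.card_erase_of_mem hv, smul_eq_mul] at hle
  obtain ⟨m, rfl⟩ : ∃ m, k = m + 2 := ⟨k - 2, by omega⟩
  rw [show m + 2 - 1 = m + 1 by omega] at hle
  by_contra! hlt
  have : (m + 3) * (m + 1) ≤ ((evenClass G v).card - 1) * (m + 1) :=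
    Nat.mul_le_mul_right _ (by omega)
  nlinarith

theorem adj_evenClass (hk : 3 ≤ k) (hreg : G.IsRegularOfDegree k)
    (hcommon : ∀ v, ∀ z ∈ evenClass G v, z ≠ v →
      k ≤ (G.neighborFinset v ∩ G.neighborFinset z).card + 1) {v b : V} (hvb : G.Adj v b)
    {x y : V} (hx : x ∈ evenClass G v) (hxy : G.Adj x y) : y ∈ evenClass G b := by
  obtain ⟨c, hxc, hvc⟩ := mem_evenClass.mp hx
  exact evenClass_trans hk hreg hcommon (mem_evenClass.mpr ⟨x, hxy.symm, hxc.symm⟩)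
    (mem_evenClass.mpr ⟨v, hvc.symm, hvb.symm⟩)

theorem mem_evenClass_or (hk : 3 ≤ k) (hreg : G.IsRegularOfDegree k) (hconn : G.Connected)
    (hcommon : ∀ v, ∀ z ∈ evenClass G v, z ≠ v →
      k ≤ (G.neighborFinset v ∩ G.neighborFinset z).card + 1) {v b : V} (hvb : G.Adj v b) (x : V) :
    x ∈ evenClass G v ∨ x ∈ evenClass G b := by
  obtain ⟨p⟩ := hconn.preconnected v x
  have key : ∀ {x y : V}, G.Walk x y → x ∈ evenClass G v ∨ x ∈ evenClass G b →
      y ∈ evenClass G v ∨ y ∈ evenClass G b := by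
    intro x y p
    induction p with
    | nil => exact id
    | cons h p ih =>
      exact fun hx => ih (hx.symm.imp (fun hx => adj_evenClass hk hreg hcommon hvb.symm hx h)
        fun hx => adj_evenClass hk hreg hcommon hvb hx h)
  exact key p (Or.inl (mem_evenClass.mpr ⟨b, hvb, hvb⟩))

/-- A large enough triangle-free graph satisfying the common neighbour condition is the crown graph
on `2 * k + 2` vertices. -/
theorem exists_bijective_of_common_neighbors (hk : 3 ≤ k) (hreg : G.IsRegularOfDegree k)
    (hconn : G.Connected) (hcard : 2 * k + 2 ≤ Fintype.card V)
    (hfree : ∀ x y z, G.Adj x y → G.Adj x z → ¬ G.Adj y z)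
    (hcommon : ∀ v, ∀ z ∈ evenClass G v, z ≠ v →
      k ≤ (G.neighborFinset v ∩ G.neighborFinset z).card + 1) :
    ∃ f : Fin 2 × Fin (k + 1) → V, Function.Bijective f ∧
      ∀ p q, G.Adj (f p) (f q) ↔ p.1 ≠ q.1 ∧ p.2 ≠ q.2 := by
  obtain ⟨v⟩ := hconn.nonempty
  obtain ⟨b, hb⟩ := Finset.card_pos.mp
    (show 0 < (G.neighborFinset v).card by rw [G.card_neighborFinset_eq_degree, hreg v]; omega)
  rw [SimpleGraph.mem_neighborFinset] at hb
  set A := evenClass G v with hA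
  set B := evenClass G b with hB
  have hAB (x : V) : x ∈ A ∨ x ∈ B := mem_evenClass_or hk hreg hconn hcommon hb x
  have hNA {x y : V} : x ∈ A → G.Adj x y → y ∈ B := adj_evenClass hk hreg hcommon hb
  have hNB {x y : V} : x ∈ B → G.Adj x y → y ∈ A := adj_evenClass hk hreg hcommon hb.symm
  have hAle : A.card ≤ k + 1 := card_evenClass_le (by omega) hreg hcommon v
  have hBle : B.card ≤ k + 1 := card_evenClass_le (by omega) hreg hcommon b
  have huniv : (Finset.univ : Finset V) = A ∪ B := by ext x; simp [hAB x]
  have hle : Fintype.card V ≤ A.card + B.card := by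
    rw [← Finset.card_univ, huniv]; exact Finset.card_union_le A B
  have hindep (u : V) {x y : V} (hx : x ∈ evenClass G u) (hy : y ∈ evenClass G u) :
      ¬ G.Adj x y := by
    have hy' : u ∈ evenClass G y := by simpa [mem_evenClass, and_comm] using hy
    obtain ⟨c, hxc, hyc⟩ := mem_evenClass.mp (evenClass_trans hk hreg hcommon hx hy')
    exact hfree c x y hxc.symm hyc.symm
  have hmate (a : V) (ha : a ∈ A) : ∃ m, B \ G.neighborFinset a = {m} := by
    have hsub : G.neighborFinset a ⊆ B := fun y hy => hNA ha (by simpa using hy)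
    rw [← Finset.card_eq_one, Finset.card_sdiff_of_subset hsub, G.card_neighborFinset_eq_degree,
      hreg a]
    omega
  have hmate' (y : V) (hy : y ∈ B) : ∃ a ∈ A, ¬ G.Adj a y := by
    by_contra! hall
    have := Finset.card_le_card (show A ⊆ G.neighborFinset y from fun a ha => by
      simpa using (hall a ha).symm)
    rw [G.card_neighborFinset_eq_degree, hreg y] at this
    omega
  choose! μ hμ using hmate
  have hμ' {a y : V} (ha : a ∈ A) (hy : y ∈ B) : G.Adj a y ↔ y ≠ μ a := by
    have : y ∈ B \ G.neighborFinset a ↔ y ∈ ({μ a} : Finset V) := by rw [hμ a ha]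
    simp only [Finset.mem_sdiff, hy, SimpleGraph.mem_neighborFinset, Finset.mem_singleton,
      true_and] at this
    rw [Ne, ← this, not_not]
  have hμB {a : V} (ha : a ∈ A) : μ a ∈ B :=
    (Finset.mem_sdiff.mp (hμ a ha ▸ Finset.mem_singleton_self (μ a))).1
  have e : Fin (k + 1) ≃ A := (A.equivFinOfCardEq (by omega)).symm
  let f : Fin 2 × Fin (k + 1) → V := fun p => if p.1 = 0 then e p.2 else μ (e p.2)
  have hsurj : Function.Surjective f := by
    intro x
    rcases hAB x with hx | hx
    · exact ⟨(0, e.symm ⟨x, hx⟩), by simp [f]⟩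
    · obtain ⟨a, ha, hax⟩ := hmate' x hx
      exact ⟨(1, e.symm ⟨a, ha⟩), by simpa [f, hμ' ha hx, eq_comm] using hax⟩
  have hbij : Function.Bijective f := by
    rw [Fintype.bijective_iff_surjective_and_card]
    refine ⟨hsurj, ?_⟩
    simp only [Fintype.card_prod, Fintype.card_fin]
    omega
  have hadj (i j : Fin (k + 1)) : G.Adj (f (0, i)) (f (1, j)) ↔ i ≠ j := by
    have h1 : f (0, i) = e i := by simp [f]
    have h2 (j : Fin (k + 1)) : f (1, j) = μ (e j) := by simp [f]
    rw [h1, h2 j, hμ' (e i).2 (hμB (e j).2), ← h2 i, ← h2 j, hbij.1.ne_iff]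
    simp [eq_comm]
  have hfA (i : Fin (k + 1)) : f (0, i) ∈ A := by simp [f]
  have hfB (i : Fin (k + 1)) : f (1, i) ∈ B := by simpa [f] using hμB (e i).2
  refine ⟨f, hbij, ?_⟩
  rintro ⟨s, i⟩ ⟨t, j⟩
  fin_cases s <;> fin_cases t
  · simpa using hindep v (hfA i) (hfA j)
  · simpa using hadj i j
  · simpa [G.adj_comm (f (1, i)), eq_comm] using hadj j i
  · simpa using hindep b (hfB i) (hfB j)

end Bipartite

section LineGraph

variable {α β : Type*}

/-- The edge of a complete bipartite graph joining the two components of a pair. -/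
def completeBipartiteEdge (p : α × β) : (completeBipartiteGraph α β).edgeSet :=
  ⟨s(Sum.inl p.1, Sum.inr p.2), by simp⟩

theorem completeBipartiteEdge_bijective :
    Function.Bijective (completeBipartiteEdge : α × β → _) := by
  constructor
  · intro p q h
    simpa [completeBipartiteEdge, Prod.ext_iff] using h
  · rintro ⟨e, he⟩
    induction e with
    | h x y =>
      rcases x with x | x <;> rcases y with y | y <;> simp at he
      · exact ⟨(x, y), rfl⟩
      · exact ⟨(y, x), Subtype.ext Sym2.eq_swap⟩

/-- Pairs with both components distinct are adjacent in the complement of the line graph of a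
complete bipartite graph. -/
theorem compl_lineGraph_adj_completeBipartiteEdge (p q : α × β) :
    ((completeBipartiteGraph α β).lineGraph)ᶜ.Adj (completeBipartiteEdge p)
      (completeBipartiteEdge q) ↔ p.1 ≠ q.1 ∧ p.2 ≠ q.2 := by
  rw [SimpleGraph.compl_adj, SimpleGraph.lineGraph_adj_iff_exists,
    completeBipartiteEdge_bijective.1.ne_iff]
  simp [completeBipartiteEdge, Prod.ext_iff]
  tauto

end LineGraph

theorem stmt14 (k : ℕ) (hk : 11 ≤ k)
    {V : Type*} [Fintype V] [DecidableEq V] (G : SimpleGraph V) [DecidableRel G.Adj]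
    (hconn : G.Connected) (hreg : G.IsRegularOfDegree k)
    (hlam : secondEigenvalue G ≤ 1) :
    Fintype.card V ≤ 2 * k + 2 ∧
      (Fintype.card V = 2 * k + 2 ↔
        Nonempty (G ≃g ((completeBipartiteGraph (Fin 2) (Fin (k + 1))).lineGraph)ᶜ)) := by
  have hedge : Nat.card (completeBipartiteGraph (Fin 2) (Fin (k + 1))).edgeSet = 2 * k + 2 := by
    rw [← Nat.card_eq_of_bijective _ completeBipartiteEdge_bijective, Nat.card_eq_fintype_card,
      Fintype.card_prod, Fintype.card_fin, Fintype.card_fin]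
    ring
  have hlarge (hcard : 2 * k + 2 ≤ Fintype.card V) :
      Nonempty (G ≃g ((completeBipartiteGraph (Fin 2) (Fin (k + 1))).lineGraph)ᶜ) := by
    obtain ⟨w, h, hw, hh⟩ := exists_root_representation G (by omega) hreg hcard hlam
    have hfree (x y z : V) (hxy : G.Adj x y) (hxz : G.Adj x z) : ¬ G.Adj y z :=
      fun hyz => hw.not_triangle hh hk hreg hcard hxy hxz hyz
    obtain ⟨f, hf, hadj⟩ := exists_bijective_of_common_neighbors (by omega) hreg hconn hcard hfree
      fun v z hz hne => by
        obtain ⟨c, hzc, hvc⟩ := mem_evenClass.mp hz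
        exact hw.card_common_neighbors (by omega) hreg hfree hne
          (hfree c z v hzc.symm hvc.symm) hvc hzc
    have hiso : G ≃g ((completeBipartiteGraph (Fin 2) (Fin (k + 1))).lineGraph)ᶜ :=
      { toEquiv := (Equiv.ofBijective f hf).symm.trans
          (Equiv.ofBijective _ completeBipartiteEdge_bijective)
        map_rel_iff' := by
          intro x y
          obtain ⟨p, rfl⟩ := hf.2 x
          obtain ⟨q, rfl⟩ := hf.2 y
          rw [hadj, ← compl_lineGraph_adj_completeBipartiteEdge]
          simp [Equiv.ofBijective_symm_apply_apply] }
    exact ⟨hiso⟩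
  have hcard_eq (hiso : Nonempty
      (G ≃g ((completeBipartiteGraph (Fin 2) (Fin (k + 1))).lineGraph)ᶜ)) :
      Fintype.card V = 2 * k + 2 := by
    obtain ⟨φ⟩ := hiso
    rw [← hedge, ← Nat.card_eq_fintype_card, Nat.card_congr φ.toEquiv]
  exact ⟨not_lt.mp fun hlt => hlt.ne' (hcard_eq (hlarge hlt.le)), fun h => hlarge h.ge, hcard_eq⟩
end
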